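/- arXiv:2411.01303 — 2 statements merged into one kernel-verified Lean document; each statement's English description precedes it below -/
import Mathlib

section
/- Let R be a skew-invertible Hecke symmetry on V = ℂ^N with parameter q (q ≠ 0, q ≠ ±1), let L(R) be the associated reflection equation algebra with generating matrix L, and let n ≥ 1. For every matrix P ∈ End(V^{⊗n}) that is a (noncommutative) polynomial with complex coefficients in the operators R₁, …, R_{n−1}, the element Tr_{R(1…n)}( L_{\bar{1→n}} · P ) is central in L(R). -/
open scoped BigOperators

/-- Amplification of an operator on V⊗V to positions (k, k+1) (0-based) of V^{⊗n}. -/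
def ampl2 {A : Type*} [Semiring A] (N n : ℕ)
    (M : Matrix (Fin N × Fin N) (Fin N × Fin N) A) (k : ℕ) :
    Matrix (Fin n → Fin N) (Fin n → Fin N) A := fun i j =>
  if h : k + 1 < n then
    if ∀ m : Fin n, (m : ℕ) ≠ k → (m : ℕ) ≠ k + 1 → i m = j m then
      M (i ⟨k, Nat.lt_of_succ_lt h⟩, i ⟨k + 1, h⟩)
        (j ⟨k, Nat.lt_of_succ_lt h⟩, j ⟨k + 1, h⟩)
    else 0
  else 0

/-- Amplification of an operator on V to position k (0-based) of V^{⊗n}. -/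
def ampl1 {A : Type*} [Semiring A] (N n : ℕ)
    (X : Matrix (Fin N) (Fin N) A) (k : ℕ) :
    Matrix (Fin n → Fin N) (Fin n → Fin N) A := fun i j =>
  if h : k < n then
    if ∀ m : Fin n, (m : ℕ) ≠ k → i m = j m then
      X (i ⟨k, h⟩) (j ⟨k, h⟩)
    else 0
  else 0

/-- The R-trace of an N×N matrix over an algebra. -/
noncomputable def trR1 {A : Type*} [Ring A] [Algebra ℂ A] (N : ℕ)
    (C : Matrix (Fin N) (Fin N) ℂ) (X : Matrix (Fin N) (Fin N) A) : A :=
  ∑ i : Fin N, ∑ j : Fin N, algebraMap ℂ A (C i j) * X j i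

/-- The full R-trace over all n tensor positions. -/
noncomputable def trRn {A : Type*} [Ring A] [Algebra ℂ A] (N n : ℕ)
    (C : Matrix (Fin N) (Fin N) ℂ)
    (M : Matrix (Fin n → Fin N) (Fin n → Fin N) A) : A :=
  ∑ i : Fin n → Fin N, ∑ j : Fin n → Fin N,
    algebraMap ℂ A (∏ k : Fin n, C (i k) (j k)) * M j i

/-- The matrix L⊗I over the free algebra on N² generators. -/
noncomputable def L1F (N : ℕ) :
    Matrix (Fin N × Fin N) (Fin N × Fin N) (FreeAlgebra ℂ (Fin N × Fin N)) :=
  fun p r => if p.2 = r.2 then FreeAlgebra.ι ℂ (p.1, r.1) else 0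

/-- Defining relations of the reflection equation algebra. -/
inductive REArel (N : ℕ) (R : Matrix (Fin N × Fin N) (Fin N × Fin N) ℂ) :
    FreeAlgebra ℂ (Fin N × Fin N) → FreeAlgebra ℂ (Fin N × Fin N) → Prop
  | rel (p r : Fin N × Fin N) :
      REArel N R
        ((R.map (algebraMap ℂ (FreeAlgebra ℂ (Fin N × Fin N))) * L1F N *
            R.map (algebraMap ℂ (FreeAlgebra ℂ (Fin N × Fin N))) * L1F N) p r)
        ((L1F N * R.map (algebraMap ℂ (FreeAlgebra ℂ (Fin N × Fin N))) * L1F N *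
            R.map (algebraMap ℂ (FreeAlgebra ℂ (Fin N × Fin N)))) p r)

/-- The reflection equation algebra L(R). -/
abbrev REA (N : ℕ) (R : Matrix (Fin N × Fin N) (Fin N × Fin N) ℂ) := RingQuot (REArel N R)

/-- The generating matrix of the RE algebra. -/
noncomputable def Lgen (N : ℕ) (R : Matrix (Fin N × Fin N) (Fin N × Fin N) ℂ) :
    Matrix (Fin N) (Fin N) (REA N R) :=
  fun i j => RingQuot.mkAlgHom ℂ (REArel N R) (FreeAlgebra.ι ℂ (i, j))

/-- Defining relations of the modified reflection equation algebra. -/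
inductive MREArel (N : ℕ) (R : Matrix (Fin N × Fin N) (Fin N × Fin N) ℂ) :
    FreeAlgebra ℂ (Fin N × Fin N) → FreeAlgebra ℂ (Fin N × Fin N) → Prop
  | rel (p r : Fin N × Fin N) :
      MREArel N R
        ((R.map (algebraMap ℂ (FreeAlgebra ℂ (Fin N × Fin N))) * L1F N *
            R.map (algebraMap ℂ (FreeAlgebra ℂ (Fin N × Fin N))) * L1F N -
          L1F N * R.map (algebraMap ℂ (FreeAlgebra ℂ (Fin N × Fin N))) * L1F N *
            R.map (algebraMap ℂ (FreeAlgebra ℂ (Fin N × Fin N)))) p r)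
        ((R.map (algebraMap ℂ (FreeAlgebra ℂ (Fin N × Fin N))) * L1F N -
          L1F N * R.map (algebraMap ℂ (FreeAlgebra ℂ (Fin N × Fin N)))) p r)

/-- The modified reflection equation algebra L̂(R). -/
abbrev MREA (N : ℕ) (R : Matrix (Fin N × Fin N) (Fin N × Fin N) ℂ) := RingQuot (MREArel N R)

/-- The generating matrix of the modified RE algebra. -/
noncomputable def Lhatgen (N : ℕ) (R : Matrix (Fin N × Fin N) (Fin N × Fin N) ℂ) :
    Matrix (Fin N) (Fin N) (MREA N R) :=
  fun i j => RingQuot.mkAlgHom ℂ (MREArel N R) (FreeAlgebra.ι ℂ (i, j))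

/-- The matrices L_{\bar k}, 0-based: Lbar 0 = L₁, Lbar k = R_k Lbar (k-1) R_k⁻¹,
with R⁻¹ = R - (q - q⁻¹)I. -/
noncomputable def Lbar {A : Type*} [Ring A] [Algebra ℂ A] (N n : ℕ)
    (R : Matrix (Fin N × Fin N) (Fin N × Fin N) ℂ) (q : ℂ)
    (L : Matrix (Fin N) (Fin N) A) : ℕ → Matrix (Fin n → Fin N) (Fin n → Fin N) A
  | 0 => ampl1 N n L 0
  | k + 1 =>
      ampl2 N n (R.map (algebraMap ℂ A)) k * Lbar N n R q L k *
        ampl2 N n ((R - (q - q⁻¹) • 1).map (algebraMap ℂ A)) k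

/-- The ordered product L_{\bar 1} L_{\bar 2} ⋯ L_{\bar n}. -/
noncomputable def Ltot {A : Type*} [Ring A] [Algebra ℂ A] (N n : ℕ)
    (R : Matrix (Fin N × Fin N) (Fin N × Fin N) ℂ) (q : ℂ)
    (L : Matrix (Fin N) (Fin N) A) : Matrix (Fin n → Fin N) (Fin n → Fin N) A :=
  ((List.range n).map (Lbar N n R q L)).prod



namespace St5
set_option linter.all false

/-! ### Abstract algebra -/
section Abs
variable {S : Type*} [Ring S]

/-- Abstract conjugates. -/
def bb (r r' : ℕ → S) (l : S) : ℕ → S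
  | 0 => l
  | k + 1 => r k * bb r r' l k * r' k

def TT (r : ℕ → S) : ℕ → S
  | 0 => 1
  | k + 1 => TT r k * r k

/-- Decreasing product of the generators. -/
def UU (r : ℕ → S) : ℕ → S
  | 0 => 1
  | k + 1 => r k * UU r k

/-- The hypotheses. -/
structure Hyp (r r' : ℕ → S) (l : S) (n : ℕ) : Prop where
  inv1 : ∀ k < n, r k * r' k = 1
  inv2 : ∀ k < n, r' k * r k = 1
  braid : ∀ k, k + 1 < n → r k * r (k+1) * r k = r (k+1) * r k * r (k+1)
  far : ∀ j k, j + 2 ≤ k → k < n → Commute (r j) (r k)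
  lcomm : ∀ k, 1 ≤ k → k < n → Commute l (r k)
  re : 0 < n → r 0 * l * r 0 * l = l * r 0 * l * r 0

variable {r r' : ℕ → S} {l : S} {n : ℕ}

lemma commute_inv {x y y' : S} (h : Commute x y) (h1 : y * y' = 1) (h2 : y' * y = 1) :
    Commute x y' := by
  show x * y' = y' * x
  calc x * y' = y' * y * x * y' := by rw [h2, one_mul]
    _ = y' * (x * y) * y' := by rw [h.eq]; simp only [mul_assoc]
    _ = y' * x * (y * y') := by simp only [mul_assoc]
    _ = y' * x := by rw [h1, mul_one]

lemma Hyp.bcomm_hi (H : Hyp r r' l n) (k : ℕ) : ∀ j, k < j → j < n → Commute (bb r r' l k) (r j) := by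
  induction k with
  | zero => intro j h1 h2; exact H.lcomm j h1 h2
  | succ k ih =>
    intro j h1 h2
    have hc := H.far k j (by omega) h2
    exact ((hc.mul_left (ih j (by omega) h2))).mul_left
      (commute_inv hc.symm (H.inv1 k (by omega)) (H.inv2 k (by omega))).symm

lemma Hyp.bcomm_lo (H : Hyp r r' l n) (k : ℕ) : ∀ j, j + 2 ≤ k → k ≤ n → Commute (r j) (bb r r' l k) := by
  induction k with
  | zero => intro j h1 h2; omega
  | succ k ih =>
    intro j h1 h2
    rcases Nat.lt_or_ge (j + 1) k with h | h
    · have hc := H.far j k (by omega) (by omega)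
      exact (hc.mul_right (ih j (by omega) (by omega))).mul_right
        (commute_inv hc (H.inv1 k (by omega)) (H.inv2 k (by omega)))
    · obtain rfl : k = j + 1 := by omega
      have e : r (j+1) * (r' j * r' (j+1)) = r' j * r' (j+1) * r j := by
        calc r (j+1) * (r' j * r' (j+1))
            = (r' j * (r' (j+1) * r (j+1)) * r j) * (r (j+1) * (r' j * r' (j+1))) := by
              rw [H.inv2 (j+1) (by omega), mul_one, H.inv2 j (by omega), one_mul]
          _ = r' j * r' (j+1) * (r (j+1) * r j * r (j+1)) * (r' j * r' (j+1)) := by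
              simp only [mul_assoc]
          _ = r' j * r' (j+1) * (r j * (r (j+1) * ((r j * r' j) * r' (j+1)))) := by
              rw [← H.braid j (by omega)]; simp only [mul_assoc]
          _ = r' j * r' (j+1) * r j := by
              rw [H.inv1 j (by omega), one_mul, H.inv1 (j+1) (by omega), mul_one]
      have hb := (H.bcomm_hi j (j+1) (by omega) (by omega)).eq
      show r j * (r (j+1) * (r j * bb r r' l j * r' j) * r' (j+1)) =
        (r (j+1) * (r j * bb r r' l j * r' j) * r' (j+1)) * r j
      calc r j * (r (j+1) * (r j * bb r r' l j * r' j) * r' (j+1))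
          = (r j * r (j+1) * r j) * bb r r' l j * (r' j * r' (j+1)) := by simp only [mul_assoc]
        _ = r (j+1) * r j * (r (j+1) * bb r r' l j) * (r' j * r' (j+1)) := by
            rw [H.braid j (by omega)]; simp only [mul_assoc]
        _ = r (j+1) * r j * bb r r' l j * (r (j+1) * (r' j * r' (j+1))) := by
            rw [← hb]; simp only [mul_assoc]
        _ = _ := by rw [e]; simp only [mul_assoc]

lemma Hyp.re_all (H : Hyp r r' l n) (k : ℕ) (hk : k < n) :
    r k * bb r r' l k * r k * bb r r' l k = bb r r' l k * r k * bb r r' l k * r k := by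
  induction k with
  | zero => exact H.re hk
  | succ k ih =>
    have ih := ih (by omega)
    set w := r k * r (k+1) with hw
    set w' := r' (k+1) * r' k with hw'
    have ww : w' * w = 1 := by
      rw [hw, hw', mul_assoc, ← mul_assoc (r' k), H.inv2 k (by omega), one_mul, H.inv2 _ hk]
    have ww2 : w * w' = 1 := by
      rw [hw, hw', mul_assoc, ← mul_assoc (r (k+1)), H.inv1 _ hk, one_mul, H.inv1 k (by omega)]
    have e1 : w * r k = r (k+1) * w := by
      rw [hw, H.braid k hk]; simp only [mul_assoc]
    have e2 : w * bb r r' l k = bb r r' l (k+1) * w := by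
      have hb := (H.bcomm_hi k (k+1) (by omega) hk).eq
      show _ = (r k * bb r r' l k * r' k) * (r k * r (k+1))
      rw [hw, mul_assoc, ← hb, mul_assoc _ (r' k), ← mul_assoc (r' k), H.inv2 k (by omega), one_mul]
      simp only [mul_assoc]
    have e1 : SemiconjBy w (r k) (r (k+1)) := e1
    have e2 : SemiconjBy w (bb r r' l k) (bb r r' l (k+1)) := e2
    have f1 := (((e1.mul_right e2).mul_right e1).mul_right e2).eq
    have f2 := (((e2.mul_right e1).mul_right e2).mul_right e1).eq
    rw [ih, f2] at f1
    have E := congrArg (fun x => x * w') f1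
    simp only [mul_assoc] at E
    rw [ww2] at E
    simp only [mul_one] at E
    simp only [mul_assoc]
    exact E.symm

/-- product of the first m of the b's. -/
def FF (b : ℕ → S) : ℕ → S
  | 0 => 1
  | k + 1 => FF b k * b k

lemma FF_eq (b : ℕ → S) (m : ℕ) : FF b m = ((List.range m).map b).prod := by
  induction m with
  | zero => simp [FF]
  | succ m ih => simp [FF, ih, List.range_succ]

lemma FF_shift (b : ℕ → S) (m : ℕ) : FF b (m+1) = b 0 * FF (fun k => b (k+1)) m := by
  induction m with
  | zero => simp [FF]
  | succ m ih => rw [FF, ih, FF, mul_assoc]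

lemma FF_comm {b : ℕ → S} {x : S} (m : ℕ) (h : ∀ k < m, Commute (b k) x) : Commute (FF b m) x := by
  induction m with
  | zero => exact Commute.one_left x
  | succ m ih => exact (ih fun k hk => h k (by omega)).mul_left (h m (by omega))

lemma Hyp.F_comm (H : Hyp r r' l n) (m : ℕ) : ∀ j, j < n → j + 2 ≤ m → m ≤ n + 1 →
    Commute (FF (bb r r' l) m) (r j) := by
  induction m with
  | zero => intro j h1 h2; omega
  | succ m ih =>
    intro j h1 h2 h3
    rcases Nat.lt_or_ge (j + 1) m with h | h
    · exact (ih j h1 (by omega) (by omega)).mul_left (H.bcomm_lo m j (by omega) (by omega)).symm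
    · obtain rfl : m = j + 1 := by omega
      show Commute (FF (bb r r' l) j * bb r r' l j * bb r r' l (j+1)) (r j)
      rw [mul_assoc]
      refine (FF_comm j fun k hk => H.bcomm_hi k j hk h1).mul_left ?_
      show bb r r' l j * (r j * bb r r' l j * r' j) * r j = r j * (bb r r' l j * (r j * bb r r' l j * r' j))
      have := H.re_all j h1
      calc _ = bb r r' l j * r j * bb r r' l j * (r' j * r j) := by simp only [mul_assoc]
        _ = (bb r r' l j * r j * bb r r' l j * r j) * r' j := by
            rw [H.inv2 j h1, mul_assoc _ (r j) (r' j), H.inv1 j h1]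
        _ = _ := by rw [← this]; simp only [mul_assoc]

lemma TT_comm {r : ℕ → S} {x : S} (m : ℕ) (h : ∀ k < m, Commute (r k) x) : Commute (TT r m) x := by
  induction m with
  | zero => exact Commute.one_left x
  | succ m ih => exact (ih fun k hk => h k (by omega)).mul_left (h m (by omega))

lemma UU_comm {r : ℕ → S} {x : S} (m : ℕ) (h : ∀ k < m, Commute (r k) x) : Commute (UU r m) x := by
  induction m with
  | zero => exact Commute.one_left x
  | succ m ih => exact (h m (by omega)).mul_left (ih fun k hk => h k (by omega))

lemma Hyp.T_b (H : Hyp r r' l n) (m : ℕ) : ∀ j, j < m → m ≤ n →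
    TT r m * bb r r' l j = bb r r' l (j+1) * TT r m := by
  induction m with
  | zero => intro j h1 h2; omega
  | succ m ih =>
    intro j h1 h2
    rcases Nat.lt_or_ge j m with h | h
    · rw [TT, mul_assoc, ← (H.bcomm_hi j m h (by omega)).eq, ← mul_assoc, ih j h (by omega), mul_assoc]
    · obtain rfl : j = m := by omega
      have hc : Commute (TT r j) (bb r r' l (j+1)) :=
        TT_comm j fun k hk => H.bcomm_lo (j+1) k (by omega) (by omega)
      have e : r j * bb r r' l j = bb r r' l (j+1) * r j := by
        show _ = (r j * bb r r' l j * r' j) * r j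
        rw [mul_assoc _ (r' j), H.inv2 j (by omega), mul_one]
      rw [TT, mul_assoc, e, ← mul_assoc, hc.eq, mul_assoc]

lemma Hyp.T_r (H : Hyp r r' l n) (m : ℕ) : ∀ j, j + 1 < m → m ≤ n →
    TT r m * r j = r (j+1) * TT r m := by
  induction m with
  | zero => intro j h1 h2; omega
  | succ m ih =>
    intro j h1 h2
    rcases Nat.lt_or_ge (j+1) m with h | h
    · rw [TT, mul_assoc, ← (H.far j m h (by omega)).eq, ← mul_assoc, ih j h (by omega), mul_assoc]
    · obtain rfl : m = j + 1 := by omega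
      have hc : Commute (TT r j) (r (j+1)) :=
        TT_comm j fun k hk => H.far k (j+1) (by omega) (by omega)
      calc TT r j * r j * r (j+1) * r j = TT r j * (r j * r (j+1) * r j) := by simp only [mul_assoc]
        _ = (TT r j * r (j+1)) * r j * r (j+1) := by
          rw [H.braid j (by omega)]; simp only [mul_assoc]
        _ = _ := by rw [hc.eq]; simp only [TT, mul_assoc]

lemma Hyp.U_r (H : Hyp r r' l n) (m : ℕ) : ∀ j, j + 1 < m → m ≤ n →
    UU r m * r (j+1) = r j * UU r m := by
  induction m with
  | zero => intro j h1 h2; omega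
  | succ m ih =>
    intro j h1 h2
    rcases Nat.lt_or_ge (j+1) m with h | h
    · rw [UU, mul_assoc, ih j h (by omega), ← mul_assoc, ← (H.far j m h (by omega)).eq, mul_assoc]
    · obtain rfl : m = j + 1 := by omega
      have hc : Commute (UU r j) (r (j+1)) :=
        UU_comm j fun k hk => H.far k (j+1) (by omega) (by omega)
      calc r (j+1) * (r j * UU r j) * r (j+1) = r (j+1) * r j * (UU r j * r (j+1)) := by
            simp only [mul_assoc]
        _ = (r (j+1) * r j * r (j+1)) * UU r j := by rw [hc.eq]; simp only [mul_assoc]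
        _ = _ := by rw [← H.braid j (by omega)]; simp only [UU, mul_assoc]

lemma Hyp.U_l (H : Hyp r r' l n) (m : ℕ) : m ≤ n → UU r m * l = bb r r' l m * UU r m := by
  induction m with
  | zero => intro _; simp [UU, bb]
  | succ m ih =>
    intro h
    show r m * UU r m * l = (r m * bb r r' l m * r' m) * (r m * UU r m)
    rw [mul_assoc, ih (by omega), mul_assoc _ (r' m), ← mul_assoc (r' m), H.inv2 m (by omega), one_mul,
      mul_assoc]

lemma TU_inv (H1 : ∀ k < n, r k * r' k = 1) (m : ℕ) (h : m ≤ n) : TT r m * UU r' m = 1 := by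
  induction m with
  | zero => simp [TT, UU]
  | succ m ih =>
    rw [TT, UU, mul_assoc, ← mul_assoc (r m), H1 m (by omega), one_mul, ih (by omega)]

lemma UT_inv (H1 : ∀ k < n, r k * r' k = 1) (m : ℕ) (h : m ≤ n) : UU r m * TT r' m = 1 := by
  induction m with
  | zero => simp [TT, UU]
  | succ m ih =>
    rw [TT, UU, mul_assoc, ← mul_assoc (UU r m), ih (by omega), one_mul, H1 m (by omega)]

lemma Hyp.gen (H : Hyp r r' l n) (j : ℕ) (hj : j + 1 < n) :
    Commute (UU r n * TT r n) (r j) ∧ Commute (bb r r' l n) (r j) := by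
  refine ⟨?_, (H.bcomm_lo n j hj le_rfl).symm⟩
  show UU r n * TT r n * r j = r j * (UU r n * TT r n)
  rw [mul_assoc, H.T_r n j hj le_rfl, ← mul_assoc, H.U_r n j hj le_rfl, mul_assoc]

lemma Hyp.main (H : Hyp r r' l n) (p : S) (h1 : Commute (UU r n * TT r n) p)
    (h2 : Commute (bb r r' l n) p) :
    l * (TT r n * (FF (bb r r' l) n * p) * UU r' n) =
      (TT r' n * (FF (bb r r' l) n * p) * UU r n) * l := by
  have t1 := TU_inv H.inv1 n le_rfl
  have u2 := TU_inv H.inv2 n le_rfl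
  have u1 := UT_inv H.inv1 n le_rfl
  have hS : TT r n * FF (bb r r' l) n = FF (fun k => bb r r' l (k+1)) n * TT r n := by
    have : ∀ m ≤ n, TT r n * FF (bb r r' l) m = FF (fun k => bb r r' l (k+1)) m * TT r n := by
      intro m
      induction m with
      | zero => intro _; simp [FF]
      | succ m ih =>
        intro hm
        rw [FF, ← mul_assoc, ih (by omega), mul_assoc, H.T_b n m (by omega) le_rfl, FF, mul_assoc]
    exact this n le_rfl
  have hF := FF_shift (bb r r' l) n
  have hU : Commute (FF (bb r r' l) (n+1)) (UU r n) :=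
    (UU_comm n fun k hk => (H.F_comm (n+1) k hk (by omega) le_rfl).symm).symm
  have hU' : Commute (FF (bb r r' l) (n+1)) (TT r' n) := commute_inv hU u1 u2
  have hp : TT r n * p * UU r' n = TT r' n * p * UU r n := by
    calc TT r n * p * UU r' n = (TT r' n * UU r n) * TT r n * p * UU r' n := by rw [u2, one_mul]
      _ = TT r' n * ((UU r n * TT r n) * p) * UU r' n := by simp only [mul_assoc]
      _ = TT r' n * p * UU r n * (TT r n * UU r' n) := by rw [h1.eq]; simp only [mul_assoc]
      _ = _ := by rw [t1, mul_one]
  calc l * (TT r n * (FF (bb r r' l) n * p) * UU r' n)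
      = l * (TT r n * FF (bb r r' l) n) * p * UU r' n := by simp only [mul_assoc]
    _ = (l * FF (fun k => bb r r' l (k+1)) n) * (TT r n * p * UU r' n) := by
        rw [hS]; simp only [mul_assoc]
    _ = FF (bb r r' l) (n+1) * TT r' n * p * UU r n := by
        rw [hF, hp]; simp only [bb, mul_assoc]
    _ = TT r' n * FF (bb r r' l) n * (bb r r' l n * p) * UU r n := by
        rw [hU'.eq, FF]; simp only [mul_assoc]
    _ = TT r' n * FF (bb r r' l) n * p * (bb r r' l n * UU r n) := by
        rw [h2.eq]; simp only [mul_assoc]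
    _ = _ := by rw [← H.U_l n le_rfl]; simp only [mul_assoc]

end Abs

/-! ### Amplification -/
section Amp
open Classical
variable {A : Type*} [Ring A] {V : Type*} [Fintype V]
variable {α β γ : Type*} [Fintype α] [Fintype β] [Fintype γ] [DecidableEq α] [DecidableEq β] [DecidableEq γ]

/-- General amplification along a map of positions. -/
noncomputable def amp (f : β → α) (M : Matrix (β → V) (β → V) A) : Matrix (α → V) (α → V) A :=
  fun i j => if ∀ x, (∀ y, f y ≠ x) → i x = j x then M (i ∘ f) (j ∘ f) else 0

lemma amp_map {B : Type*} [Ring B] (φ : A →+* B) (f : β → α) (M : Matrix (β → V) (β → V) A) :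
    amp f (M.map φ) = (amp f M).map φ := by
  ext i j
  simp only [amp, Matrix.map_apply]
  split_ifs <;> simp

lemma amp_mul {f : β → α} (hf : Function.Injective f) (M M' : Matrix (β → V) (β → V) A) :
    amp f (M * M') = amp f M * amp f M' := by
  ext i k
  rw [Matrix.mul_apply]
  have hinj : Function.Injective (fun y : β → V => Function.extend f y i) := by
    intro y y' h
    funext b
    have := congrFun h (f b)
    simpa [hf.extend_apply] using this
  by_cases hik : ∀ x, (∀ y, f y ≠ x) → i x = k x
  · rw [amp, if_pos hik, Matrix.mul_apply]
    refine Fintype.sum_of_injective _ hinj _ _ ?_ ?_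
    · intro j hj
      have : ¬ ∀ x, (∀ y, f y ≠ x) → i x = j x := by
        intro h
        apply hj
        refine ⟨j ∘ f, ?_⟩
        funext x
        by_cases hx : ∃ y, f y = x
        · obtain ⟨y, rfl⟩ := hx
          simp [hf.extend_apply]
        · simp only [Function.extend_apply' _ _ _ hx]
          exact h x (by simpa using hx)
      rw [amp, if_neg this, zero_mul]
    · intro y
      have hx : ∀ x, (∀ y, f y ≠ x) → Function.extend f y i x = i x := fun x hx =>
        Function.extend_apply' _ _ _ (by simpa using hx)
      have hc : Function.extend f y i ∘ f = y := by
        funext b; simp [hf.extend_apply]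
      rw [amp, amp, if_pos (fun x h => (hx x h).symm), if_pos (fun x h => (hx x h).trans (hik x h)), hc]
  · rw [amp, if_neg hik]
    symm
    refine Finset.sum_eq_zero fun j _ => ?_
    simp only [amp]
    split_ifs with h1 h2
    · exact absurd (fun x hx => (h1 x hx).trans (h2 x hx)) hik
    all_goals simp

lemma amp_one [DecidableEq (α → V)] [DecidableEq (β → V)] (f : β → α) :
    amp f (1 : Matrix (β → V) (β → V) A) = 1 := by
  ext i j
  simp only [amp, Matrix.one_apply]
  by_cases h : i = j
  · subst h; simp
  · rw [if_neg h]
    split_ifs with h1 h2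
    · exfalso; apply h; funext x
      by_cases hx : ∃ y, f y = x
      · obtain ⟨y, rfl⟩ := hx; exact congrFun h2 y
      · exact h1 x (by simpa using hx)
    all_goals rfl

lemma amp_amp {f : β → α} (g : γ → β) (hf : Function.Injective f) (M : Matrix (γ → V) (γ → V) A) :
    amp f (amp g M) = amp (f ∘ g) M := by
  ext i j
  simp only [amp]
  by_cases h : ∀ x, (∀ y, (f ∘ g) y ≠ x) → i x = j x
  · rw [if_pos h, if_pos, if_pos]
    · rfl
    · intro x hx; exact h _ (fun y hy => hx y (hf hy))
    · intro x hx; exact h _ (fun y => hx (g y))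
  · rw [if_neg h]
    split_ifs with h1 h2
    · exfalso; apply h; intro x hx
      by_cases hb : ∃ y, f y = x
      · obtain ⟨y, rfl⟩ := hb
        exact h2 y (fun z hz => hx z (by simp [hz]))
      · exact h1 x (by simpa using hb)
    all_goals rfl

lemma amp_mul_disj {f : β → α} {g : γ → α} (hd : ∀ b c, f b ≠ g c)
    (M : Matrix (β → V) (β → V) A) (M' : Matrix (γ → V) (γ → V) A) (i k : α → V) :
    (amp f M * amp g M') i k = if ∀ x, (∀ y, f y ≠ x) → (∀ y, g y ≠ x) → i x = k x then
      M (i ∘ f) (k ∘ f) * M' (i ∘ g) (k ∘ g) else 0 := by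
  rw [Matrix.mul_apply]
  set j0 : α → V := fun x => if ∃ b, f b = x then k x else i x with hj0
  have key : ∀ j, (∀ x, (∀ y, f y ≠ x) → i x = j x) → (∀ x, (∀ y, g y ≠ x) → j x = k x) → j = j0 := by
    intro j h1 h2
    funext x
    by_cases hx : ∃ b, f b = x
    · obtain ⟨b, rfl⟩ := hx
      simp only [hj0, exists_apply_eq_apply, if_true]
      exact h2 _ (fun y hy => hd b y hy.symm)
    · simp only [hj0, if_neg hx]
      exact (h1 x (by simpa using hx)).symm
  rw [Finset.sum_eq_single j0]
  · have e1 : ∀ x, (∀ y, f y ≠ x) → i x = j0 x := by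
      intro x hx
      have : ¬ ∃ b, f b = x := by simpa using hx
      simp only [hj0, if_neg this]
    have e2 : j0 ∘ f = k ∘ f := by funext b; simp [hj0]
    have e3 : j0 ∘ g = i ∘ g := by
      funext c
      have : ¬ ∃ b, f b = g c := fun ⟨b, hb⟩ => hd b c hb
      simp [hj0, this]
    rw [amp, amp, if_pos e1, e2, e3]
    by_cases h : ∀ x, (∀ y, f y ≠ x) → (∀ y, g y ≠ x) → i x = k x
    · rw [if_pos h, if_pos]
      intro x hx
      by_cases hb : ∃ b, f b = x
      · simp [hj0, hb]
      · simp only [hj0, if_neg hb]; exact h x (by simpa using hb) hx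
    · rw [if_neg h, if_neg, mul_zero]
      intro h'
      apply h
      intro x h1 h2
      rw [e1 x h1, h' x h2]
  · intro j _ hj
    simp only [amp]
    split_ifs with h1 h2
    · exact absurd (key j h1 h2) hj
    all_goals simp
  · intro h; exact absurd (Finset.mem_univ _) h

lemma amp_comm {f : β → α} {g : γ → α} (hd : ∀ b c, f b ≠ g c)
    (M : Matrix (β → V) (β → V) A) (M' : Matrix (γ → V) (γ → V) A)
    (hc : ∀ a b c d, Commute (M a b) (M' c d)) :
    Commute (amp f M) (amp g M') := by
  show amp f M * amp g M' = amp g M' * amp f M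
  ext i k
  rw [amp_mul_disj hd, amp_mul_disj (fun b c => (hd c b).symm)]
  simp only [(hc _ _ _ _).eq]
  congr 1
  apply propext
  exact ⟨fun h x h1 h2 => h x h2 h1, fun h x h1 h2 => h x h2 h1⟩

/-- Pair-indexed matrix as matrix on functions from Fin 2. -/
def pr (M : Matrix (V × V) (V × V) A) : Matrix (Fin 2 → V) (Fin 2 → V) A :=
  M.submatrix (finTwoArrowEquiv V) (finTwoArrowEquiv V)

/-- Single-indexed matrix as matrix on functions from Fin 1. -/
def sg (M : Matrix V V A) : Matrix (Fin 1 → V) (Fin 1 → V) A :=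
  fun i j => M (i 0) (j 0)

lemma pr_mul (M M' : Matrix (V × V) (V × V) A) : pr (M * M') = pr M * pr M' := by
  simp only [pr, Matrix.submatrix_mul_equiv]

lemma pr_one [DecidableEq (V × V)] [DecidableEq (Fin 2 → V)] :
    pr (1 : Matrix (V × V) (V × V) A) = 1 := by
  simp only [pr, Matrix.submatrix_one_equiv]

/-- positions k, k+1 -/
def pos2 (n k : ℕ) (h : k + 1 < n) : Fin 2 → Fin n := ![⟨k, Nat.lt_of_succ_lt h⟩, ⟨k+1, h⟩]

lemma pos2_inj (n k : ℕ) (h : k + 1 < n) : Function.Injective (pos2 n k h) := by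
  intro a b
  fin_cases a <;> fin_cases b <;> simp [pos2]

lemma ampl2_eq (N n k : ℕ) (h : k + 1 < n) (M : Matrix (Fin N × Fin N) (Fin N × Fin N) A) :
    ampl2 N n M k = amp (pos2 n k h) (pr M) := by
  ext i j
  simp only [ampl2, amp, dif_pos h]
  congr 1
  apply propext
  refine forall_congr' fun m => ?_
  have : (∀ y, pos2 n k h y ≠ m) ↔ ((m : ℕ) ≠ k ∧ (m : ℕ) ≠ k + 1) := by
    simp [Fin.forall_fin_two, pos2, Fin.ext_iff, eq_comm]
  rw [this, and_imp]

lemma ampl1_eq (N n k : ℕ) (h : k < n) (M : Matrix (Fin N) (Fin N) A) :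
    ampl1 N n M k = amp (fun _ : Fin 1 => (⟨k, h⟩ : Fin n)) (sg M) := by
  ext i j
  simp only [ampl1, amp, dif_pos h]
  congr 1
  apply propext
  refine forall_congr' fun m => ?_
  simp [Fin.ext_iff, eq_comm]

end Amp

/-! ### Partial traces -/
section Tr
open Classical
variable {A : Type*} [Ring A] [Algebra ℂ A] {N : ℕ}

/-- append an index -/
def sn {n : ℕ} (i : Fin n → Fin N) (a : Fin N) : Fin (n+1) → Fin N := Fin.snoc i a

lemma sn_castSucc {n : ℕ} (i : Fin n → Fin N) (a : Fin N) (x : Fin n) : sn i a x.castSucc = i x := by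
  simp [sn]

lemma sn_last {n : ℕ} (i : Fin n → Fin N) (a : Fin N) : sn i a (Fin.last n) = a := by
  simp [sn]

lemma sn_surj {n : ℕ} (k : Fin (n+1) → Fin N) : ∃ i a, k = sn i a :=
  ⟨Fin.init k, k (Fin.last n), by simp [sn]⟩

lemma sn_inj {n : ℕ} {i j : Fin n → Fin N} {a b : Fin N} : sn i a = sn j b ↔ i = j ∧ a = b := by
  constructor
  · intro h
    refine ⟨funext fun x => ?_, ?_⟩
    · simpa [sn_castSucc] using congrFun h x.castSucc
    · simpa [sn_last] using congrFun h (Fin.last n)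
  · rintro ⟨rfl, rfl⟩; rfl

lemma sum_sn {B : Type*} [AddCommMonoid B] {n : ℕ} (F : (Fin (n+1) → Fin N) → B) :
    ∑ k, F k = ∑ i : Fin n → Fin N, ∑ a : Fin N, F (sn i a) := by
  rw [← (Fin.snocEquiv (fun _ : Fin (n+1) => Fin N)).sum_comp, Fintype.sum_prod_type, Finset.sum_comm]
  rfl

/-- M ⊗ 1 -/
noncomputable abbrev emb {n : ℕ} (M : Matrix (Fin n → Fin N) (Fin n → Fin N) A) :
    Matrix (Fin (n+1) → Fin N) (Fin (n+1) → Fin N) A := amp Fin.castSucc M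

lemma emb_sn {n : ℕ} (M : Matrix (Fin n → Fin N) (Fin n → Fin N) A) (i j : Fin n → Fin N)
    (a b : Fin N) : emb M (sn i a) (sn j b) = if a = b then M i j else 0 := by
  have h1 : ∀ (i : Fin n → Fin N) a, sn i a ∘ Fin.castSucc = i := fun i a => by
    funext x; simp [sn_castSucc]
  simp only [emb, amp, h1]
  congr 1
  apply propext
  constructor
  · intro h
    have := h (Fin.last n) (fun y => (Fin.castSucc_lt_last y).ne)
    simpa [sn_last] using this
  · rintro rfl x hx
    induction x using Fin.lastCases with
    | last => simp [sn_last]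
    | cast x => exact absurd rfl (hx x)

lemma emb_mul_sn {n : ℕ} (X : Matrix (Fin n → Fin N) (Fin n → Fin N) A)
    (M : Matrix (Fin (n+1) → Fin N) (Fin (n+1) → Fin N) A) (i : Fin n → Fin N) (b : Fin N) (k) :
    (emb X * M) (sn i b) k = ∑ j, X i j * M (sn j b) k := by
  rw [Matrix.mul_apply, sum_sn]
  simp [emb_sn]

lemma mul_emb_sn {n : ℕ} (X : Matrix (Fin n → Fin N) (Fin n → Fin N) A)
    (M : Matrix (Fin (n+1) → Fin N) (Fin (n+1) → Fin N) A) (j : Fin n → Fin N) (b : Fin N) (k) :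
    (M * emb X) k (sn j b) = ∑ i, M k (sn i b) * X i j := by
  rw [Matrix.mul_apply, sum_sn]
  simp [emb_sn]

/-- partial R-trace over the last position -/
noncomputable def ptr (C : Matrix (Fin N) (Fin N) ℂ) {n : ℕ}
    (M : Matrix (Fin (n+1) → Fin N) (Fin (n+1) → Fin N) A) :
    Matrix (Fin n → Fin N) (Fin n → Fin N) A :=
  fun i j => ∑ a, ∑ b, algebraMap ℂ A (C a b) * M (sn i b) (sn j a)

lemma ptr_emb (C : Matrix (Fin N) (Fin N) ℂ) {n : ℕ}
    (X Y : Matrix (Fin n → Fin N) (Fin n → Fin N) A)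
    (M : Matrix (Fin (n+1) → Fin N) (Fin (n+1) → Fin N) A) :
    ptr C (emb X * M * emb Y) = X * ptr C M * Y := by
  ext i j
  simp only [ptr, mul_emb_sn, emb_mul_sn]
  simp only [ptr, Matrix.mul_apply]
  simp only [Finset.mul_sum, Finset.sum_mul]
  simp only [← Fintype.sum_prod_type']
  refine Fintype.sum_equiv ⟨fun p => (p.2.2.1, p.2.2.2, p.1, p.2.1),
    fun p => (p.2.2.1, p.2.2.2, p.1, p.2.1), fun _ => rfl, fun _ => rfl⟩ _ _ ?_
  rintro ⟨a, b, k, l⟩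
  simp only [Equiv.coe_fn_mk, ← mul_assoc]
  rw [Algebra.commutes (C a b) (X i l)]

lemma ampl2_last {n : ℕ} (M : Matrix (Fin N × Fin N) (Fin N × Fin N) A) (i j : Fin n → Fin N)
    (a b c d : Fin N) : ampl2 N (n+2) M n (sn (sn i a) b) (sn (sn j c) d) =
      if i = j then M (a, b) (c, d) else 0 := by
  have h : n + 1 < n + 2 := by omega
  have e1 : (⟨n+1, h⟩ : Fin (n+2)) = Fin.last (n+1) := rfl
  have e2 : (⟨n, Nat.lt_of_succ_lt h⟩ : Fin (n+2)) = (Fin.last n).castSucc := rfl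
  simp only [ampl2, dif_pos h, e1, e2, sn_last, sn_castSucc]
  congr 1
  apply propext
  constructor
  · intro h
    funext x
    have := h x.castSucc.castSucc (by simp; omega) (by simp; omega)
    simpa [sn_castSucc] using this
  · rintro rfl x h1 h2
    induction x using Fin.lastCases with
    | last => simp at h2
    | cast x =>
      induction x using Fin.lastCases with
      | last => simp at h1
      | cast x => simp [sn_castSucc]

/-- The scalar kernel. -/
noncomputable def KK (C : Matrix (Fin N) (Fin N) ℂ) (M M' : Matrix (Fin N × Fin N) (Fin N × Fin N) ℂ)
    (x y c e : Fin N) : ℂ := ∑ a, ∑ b, ∑ d, C a b * M (x, b) (c, d) * M' (e, d) (y, a)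

lemma ptr_conj_expand (C : Matrix (Fin N) (Fin N) ℂ) {n : ℕ}
    (M M' : Matrix (Fin N × Fin N) (Fin N × Fin N) ℂ)
    (X : Matrix (Fin (n+1) → Fin N) (Fin (n+1) → Fin N) A) (i j : Fin n → Fin N) (x y : Fin N) :
    ptr C (ampl2 N (n+2) (M.map (algebraMap ℂ A)) n * emb X * ampl2 N (n+2) (M'.map (algebraMap ℂ A)) n)
      (sn i x) (sn j y) = ∑ c, ∑ e, algebraMap ℂ A (KK C M M' x y c e) * X (sn i c) (sn j e) := by
  simp only [ptr, Matrix.mul_apply, sum_sn, emb_sn, ampl2_last, Matrix.map_apply, ite_mul, zero_mul,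
    mul_ite, mul_zero, Finset.sum_ite_irrel, Finset.sum_const_zero, Finset.sum_ite_eq, Finset.mem_univ,
    if_true, Finset.sum_ite_eq']
  simp only [KK, map_sum, Finset.mul_sum, Finset.sum_mul, map_mul]
  simp only [← Fintype.sum_prod_type']
  refine Fintype.sum_equiv ⟨fun p => (p.2.2.2.2, p.2.2.1, p.1, p.2.1, p.2.2.2.1),
    fun p => (p.2.2.1, p.2.2.2.1, p.2.1, p.2.2.2.2, p.1), fun _ => rfl, fun _ => rfl⟩ _ _ ?_
  rintro ⟨a, b, e, d, c⟩
  simp only [Equiv.coe_fn_mk, mul_assoc]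
  rw [Algebra.commutes (M' _ _)]

lemma ptr_conj (C : Matrix (Fin N) (Fin N) ℂ) {n : ℕ}
    (M M' : Matrix (Fin N × Fin N) (Fin N × Fin N) ℂ)
    (hK : ∀ x y c e, KK C M M' x y c e = if x = y then C e c else 0)
    (X : Matrix (Fin (n+1) → Fin N) (Fin (n+1) → Fin N) A) :
    ptr C (ampl2 N (n+2) (M.map (algebraMap ℂ A)) n * emb X * ampl2 N (n+2) (M'.map (algebraMap ℂ A)) n)
      = emb (ptr C X) := by
  ext i j
  obtain ⟨i, x, rfl⟩ := sn_surj i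
  obtain ⟨j, y, rfl⟩ := sn_surj j
  rw [ptr_conj_expand, emb_sn]
  simp only [hK]
  split_ifs
  · rw [ptr, Finset.sum_comm]
  · simp

lemma emb_ampl2 {n : ℕ} (M : Matrix (Fin N × Fin N) (Fin N × Fin N) A) (k : ℕ) (h : k + 1 < n) :
    emb (ampl2 N n M k) = ampl2 N (n+1) M k := by
  rw [ampl2_eq N n k h, ampl2_eq N (n+1) k (by omega), emb, amp_amp _ (Fin.castSucc_injective n)]
  congr 1
  funext x
  fin_cases x <;> rfl

lemma emb_ampl1 {n : ℕ} (M : Matrix (Fin N) (Fin N) A) (k : ℕ) (h : k < n) :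
    emb (ampl1 N n M k) = ampl1 N (n+1) M k := by
  rw [ampl1_eq N n k h, ampl1_eq N (n+1) k (by omega), emb, amp_amp _ (Fin.castSucc_injective n)]
  rfl

lemma ampl2_mul {n k : ℕ} (h : k + 1 < n) (M M' : Matrix (Fin N × Fin N) (Fin N × Fin N) A) :
    ampl2 N n (M * M') k = ampl2 N n M k * ampl2 N n M' k := by
  rw [ampl2_eq N n k h, ampl2_eq N n k h, ampl2_eq N n k h, pr_mul, amp_mul (pos2_inj n k h)]

lemma ampl2_one {n k : ℕ} (h : k + 1 < n) :
    ampl2 N n (1 : Matrix (Fin N × Fin N) (Fin N × Fin N) A) k = 1 := by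
  rw [ampl2_eq N n k h, pr_one, amp_one]

lemma ampl2_map {n k : ℕ} (M : Matrix (Fin N × Fin N) (Fin N × Fin N) ℂ) :
    ampl2 N n (M.map (algebraMap ℂ A)) k = (ampl2 N n M k).map (algebraMap ℂ A) := by
  ext i j
  simp only [ampl2, Matrix.map_apply]
  split_ifs <;> simp

lemma key_id (R M M' Ψ : Matrix (Fin N × Fin N) (Fin N × Fin N) ℂ) (C : Matrix (Fin N) (Fin N) ℂ)
    (hb : ampl2 N 3 M 1 * ampl2 N 3 R 0 * ampl2 N 3 M' 1 =
      ampl2 N 3 M' 0 * ampl2 N 3 R 1 * ampl2 N 3 M 0) (hM : M' * M = 1)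
    (hΨ : ∀ i j k m : Fin N, ∑ a : Fin N, ∑ b : Fin N,
        R (i, b) (j, a) * Ψ (a, k) (b, m) = if i = m ∧ k = j then 1 else 0)
    (hC : ∀ i j : Fin N, C i j = ∑ k : Fin N, Ψ (i, k) (j, k)) (x y c e : Fin N) :
    KK C M M' x y c e = if x = y then C e c else 0 := by
  have hR : ptr C (ampl2 N 3 R 1) = 1 := by
    ext i j
    obtain ⟨i, x, rfl⟩ := sn_surj i
    obtain ⟨j, y, rfl⟩ := sn_surj j
    simp only [Matrix.one_apply, sn_inj, ptr]
    simp only [ampl2_last, Algebra.algebraMap_self, RingHom.id_apply]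
    by_cases hij : i = j
    · simp only [hij, if_true, true_and, hC, Finset.sum_mul]
      have : ∀ k, ∑ a, ∑ b, Ψ (a, k) (b, k) * R (x, b) (y, a) = if x = k ∧ k = y then 1 else 0 := by
        intro k; rw [← hΨ]; simp only [mul_comm]
      calc _ = ∑ k, ∑ a, ∑ b, Ψ (a, k) (b, k) * R (x, b) (y, a) := by
            symm
            rw [Finset.sum_comm]
            exact Finset.sum_congr rfl fun a _ => Finset.sum_comm
        _ = _ := by simp [this, ite_and]
    · simp [hij]
  have h1 : ptr C (ampl2 N 3 M 1 * ampl2 N 3 R 0 * ampl2 N 3 M' 1) = 1 := by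
    rw [hb, ← emb_ampl2 (n := 2) M' 0 (by omega), ← emb_ampl2 (n := 2) M 0 (by omega), ptr_emb, hR,
      mul_one, ← ampl2_mul (by omega), hM, ampl2_one (by omega)]
  have h2 : ∀ i0 j0, ∑ c, ∑ e, KK C M M' x y c e * R (i0, c) (j0, e) =
      if i0 = j0 ∧ x = y then 1 else 0 := by
    intro i0 j0
    have := ptr_conj_expand (A := ℂ) (n := 1) C M M' (ampl2 N 2 R 0) (fun _ => i0) (fun _ => j0) x y
    rw [emb_ampl2 R 0 (by omega)] at this
    have hid : ∀ Q : Matrix (Fin N × Fin N) (Fin N × Fin N) ℂ, Q.map (algebraMap ℂ ℂ) = Q := fun Q => by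
      ext; simp
    rw [hid, hid] at this
    erw [h1] at this
    simp only [Matrix.one_apply, sn_inj] at this
    have e : ∀ i0 c, (sn (fun _ : Fin 1 => i0) c : Fin 2 → Fin N) = sn (sn (fun z : Fin 0 => z.elim0) i0) c := by
      intro i0 c
      congr 1
    simp only [e, ampl2_last, if_true, Algebra.algebraMap_self, RingHom.id_apply] at this
    rw [← this]
    congr 1
    simp [funext_iff]
  -- invert
  let B1 : Matrix (Fin N × Fin N) (Fin N × Fin N) ℂ := fun p s => R (p.1, s.1) (p.2, s.2)
  let B2 : Matrix (Fin N × Fin N) (Fin N × Fin N) ℂ := fun s p => Ψ (s.2, p.2) (s.1, p.1)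
  have hB : B1 * B2 = 1 := by
    ext ⟨i, j⟩ ⟨m, k⟩
    rw [Matrix.mul_apply, Fintype.sum_prod_type, Finset.sum_comm]
    simp only [B1, B2]
    rw [hΨ, Matrix.one_apply]
    simp [eq_comm]
  have hB' : B2 * B1 = 1 := mul_eq_one_comm.mp hB
  have h3 : B1.mulVec (fun s => KK C M M' x y s.1 s.2) = fun p => if p.1 = p.2 ∧ x = y then 1 else 0 := by
    funext p
    rw [← h2, Matrix.mulVec, dotProduct, Fintype.sum_prod_type]
    simp only [B1, mul_comm]
  have h4 := congrArg (B2.mulVec) h3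
  rw [Matrix.mulVec_mulVec, hB', Matrix.one_mulVec] at h4
  have h5 := congrFun h4 (c, e)
  simp only at h5
  rw [h5, Matrix.mulVec, dotProduct, Fintype.sum_prod_type]
  by_cases hxy : x = y
  · simp [hxy, B2, hC]
  · simp [hxy]

end Tr

section Final
open Classical
variable {A : Type*} [Ring A] [Algebra ℂ A] {N : ℕ}

/-- R-trace over all positions but the first. -/
noncomputable def tau (C : Matrix (Fin N) (Fin N) ℂ) (n : ℕ)
    (M : Matrix (Fin (n+1) → Fin N) (Fin (n+1) → Fin N) A) : Matrix (Fin N) (Fin N) A :=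
  fun x y => ∑ i : Fin n → Fin N, ∑ j : Fin n → Fin N,
    algebraMap ℂ A (∏ k : Fin n, C (i k) (j k)) *
      M (Fin.cons x j : Fin (n+1) → Fin N) (Fin.cons y i : Fin (n+1) → Fin N)

lemma prod_sn (C : Matrix (Fin N) (Fin N) ℂ) {n : ℕ} (i j : Fin n → Fin N) (a b : Fin N) :
    ∏ k : Fin (n+1), C (sn i a k) (sn j b k) = (∏ k, C (i k) (j k)) * C a b := by
  rw [Fin.prod_univ_castSucc]
  simp only [sn_castSucc, sn_last]

lemma cons_sn {n : ℕ} (x : Fin N) (i : Fin n → Fin N) (a : Fin N) :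
    (Fin.cons x (sn i a) : Fin (n+2) → Fin N) = sn (Fin.cons x i : Fin (n+1) → Fin N) a := by
  simp only [sn]
  exact Fin.cons_snoc_eq_snoc_cons _ _ _

lemma tau_succ (C : Matrix (Fin N) (Fin N) ℂ) (n : ℕ)
    (M : Matrix (Fin (n+2) → Fin N) (Fin (n+2) → Fin N) A) : tau C (n+1) M = tau C n (ptr C M) := by
  ext x y
  simp only [tau, ptr, sum_sn, prod_sn, cons_sn]
  refine Finset.sum_congr rfl fun i _ => ?_
  rw [Finset.sum_comm]
  refine Finset.sum_congr rfl fun j _ => ?_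
  rw [Finset.mul_sum]
  refine Finset.sum_congr rfl fun a _ => ?_
  rw [Finset.mul_sum]
  refine Finset.sum_congr rfl fun b _ => ?_
  rw [map_mul, mul_assoc]

lemma trRn_succ (C : Matrix (Fin N) (Fin N) ℂ) (n : ℕ)
    (M : Matrix (Fin (n+1) → Fin N) (Fin (n+1) → Fin N) A) :
    trRn N (n+1) C M = trRn N n C (ptr C M) := by
  simp only [trRn, ptr, sum_sn, prod_sn]
  refine Finset.sum_congr rfl fun i _ => ?_
  rw [Finset.sum_comm]
  refine Finset.sum_congr rfl fun j _ => ?_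
  rw [Finset.mul_sum]
  refine Finset.sum_congr rfl fun a _ => ?_
  rw [Finset.mul_sum]
  refine Finset.sum_congr rfl fun b _ => ?_
  rw [map_mul, mul_assoc]

lemma emb_mul {n : ℕ} (X Y : Matrix (Fin n → Fin N) (Fin n → Fin N) A) :
    emb (X * Y) = emb X * emb Y := amp_mul (Fin.castSucc_injective n) X Y

lemma emb_one {n : ℕ} : emb (1 : Matrix (Fin n → Fin N) (Fin n → Fin N) A) = 1 := amp_one _

lemma emb_TT {n : ℕ} (M : Matrix (Fin N × Fin N) (Fin N × Fin N) A) (m : ℕ) (h : m < n) :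
    emb (TT (ampl2 N n M) m) = TT (ampl2 N (n+1) M) m := by
  induction m with
  | zero => exact emb_one
  | succ m ih => rw [TT, emb_mul, ih (by omega), emb_ampl2 _ _ h, TT]

lemma emb_UU {n : ℕ} (M : Matrix (Fin N × Fin N) (Fin N × Fin N) A) (m : ℕ) (h : m < n) :
    emb (UU (ampl2 N n M) m) = UU (ampl2 N (n+1) M) m := by
  induction m with
  | zero => exact emb_one
  | succ m ih => rw [UU, emb_mul, ih (by omega), emb_ampl2 _ _ h, UU]

lemma tau_conj (C : Matrix (Fin N) (Fin N) ℂ)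
    (M M' : Matrix (Fin N × Fin N) (Fin N × Fin N) ℂ)
    (hK : ∀ x y c e, KK C M M' x y c e = if x = y then C e c else 0) (n : ℕ) :
    ∀ (X : Matrix (Fin n → Fin N) (Fin n → Fin N) A),
    tau C n (TT (ampl2 N (n+1) (M.map (algebraMap ℂ A))) n * emb X *
      UU (ampl2 N (n+1) (M'.map (algebraMap ℂ A))) n) = Matrix.diagonal fun _ => trRn N n C X := by
  induction n with
  | zero =>
    intro X
    ext x y
    have e : ∀ (x : Fin N) (j : Fin 0 → Fin N), (Fin.cons x j : Fin 1 → Fin N) = sn j x := by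
      intro x j; funext z; fin_cases z; rfl
    simp only [TT, UU, one_mul, mul_one, tau, trRn, e, emb_sn, Matrix.diagonal_apply]
    split_ifs <;> simp
  | succ n ih =>
    intro X
    rw [tau_succ, TT, UU]
    have := ptr_emb C (TT (ampl2 N (n+1) (M.map (algebraMap ℂ A))) n)
      (UU (ampl2 N (n+1) (M'.map (algebraMap ℂ A))) n)
      (ampl2 N (n+2) (M.map (algebraMap ℂ A)) n * emb X * ampl2 N (n+2) (M'.map (algebraMap ℂ A)) n)
    rw [ptr_conj C M M' hK, emb_TT _ _ (by omega), emb_UU _ _ (by omega)] at this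
    rw [trRn_succ, ← ih (ptr C X), ← this]
    simp only [mul_assoc]

lemma ampl1_cons {n : ℕ} (L : Matrix (Fin N) (Fin N) A) (x y : Fin N) (i j : Fin n → Fin N) :
    ampl1 N (n+1) L 0 (Fin.cons x i : Fin (n+1) → Fin N) (Fin.cons y j : Fin (n+1) → Fin N) =
      if i = j then L x y else 0 := by
  have h : 0 < n + 1 := by omega
  have e1 : (⟨0, h⟩ : Fin (n+1)) = 0 := rfl
  simp only [ampl1, dif_pos h, e1, Fin.cons_zero]
  congr 1
  apply propext
  constructor
  · intro h; funext z
    simpa using h z.succ (by simp)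
  · rintro rfl z hz
    induction z using Fin.cases with
    | zero => simp at hz
    | succ z => simp

lemma sum_cons {B : Type*} [AddCommMonoid B] {n : ℕ} (F : (Fin (n+1) → Fin N) → B) :
    ∑ k, F k = ∑ a : Fin N, ∑ i : Fin n → Fin N, F (Fin.cons a i : Fin (n+1) → Fin N) := by
  rw [← (Fin.consEquiv (fun _ : Fin (n+1) => Fin N)).sum_comp, Fintype.sum_prod_type]
  rfl

lemma tau_left (C : Matrix (Fin N) (Fin N) ℂ) {n : ℕ} (L : Matrix (Fin N) (Fin N) A)
    (M : Matrix (Fin (n+1) → Fin N) (Fin (n+1) → Fin N) A) :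
    tau C n (ampl1 N (n+1) L 0 * M) = L * tau C n M := by
  ext x y
  simp only [tau, Matrix.mul_apply, sum_cons, ampl1_cons, ite_mul, zero_mul, Finset.sum_ite_eq,
    Finset.mem_univ, if_true, Finset.mul_sum]
  simp only [← Fintype.sum_prod_type']
  refine Fintype.sum_equiv ⟨fun p => (p.2.2, p.1, p.2.1),
    fun p => (p.2.1, p.2.2, p.1), fun _ => rfl, fun _ => rfl⟩ _ _ ?_
  rintro ⟨i, j, a⟩
  simp only [Equiv.coe_fn_mk, ← mul_assoc]
  rw [Algebra.commutes _ (L x a)]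

lemma tau_right (C : Matrix (Fin N) (Fin N) ℂ) {n : ℕ} (L : Matrix (Fin N) (Fin N) A)
    (M : Matrix (Fin (n+1) → Fin N) (Fin (n+1) → Fin N) A) :
    tau C n (M * ampl1 N (n+1) L 0) = tau C n M * L := by
  ext x y
  simp only [tau, Matrix.mul_apply, sum_cons, ampl1_cons, mul_ite, mul_zero, Finset.sum_ite_eq',
    Finset.mem_univ, if_true, Finset.mul_sum, Finset.sum_mul]
  simp only [← Fintype.sum_prod_type']
  refine Fintype.sum_equiv ⟨fun p => (p.2.2, p.1, p.2.1),
    fun p => (p.2.1, p.2.2, p.1), fun _ => rfl, fun _ => rfl⟩ _ _ ?_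
  rintro ⟨i, j, a⟩
  simp only [Equiv.coe_fn_mk, mul_assoc]

/-- three consecutive positions -/
def pos3 (n k : ℕ) (h : k + 2 < n) : Fin 3 → Fin n :=
  ![⟨k, by omega⟩, ⟨k+1, by omega⟩, ⟨k+2, h⟩]

lemma pos3_inj (n k : ℕ) (h : k + 2 < n) : Function.Injective (pos3 n k h) := by
  intro a b
  fin_cases a <;> fin_cases b <;> simp [pos3]

lemma ampl2_pos3_0 {n k : ℕ} (h : k + 2 < n) (M : Matrix (Fin N × Fin N) (Fin N × Fin N) A) :
    ampl2 N n M k = amp (pos3 n k h) (ampl2 N 3 M 0) := by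
  rw [ampl2_eq N n k (by omega), ampl2_eq N 3 0 (by omega), amp_amp _ (pos3_inj n k h)]
  congr 1
  funext x
  fin_cases x <;> rfl

lemma ampl2_pos3_1 {n k : ℕ} (h : k + 2 < n) (M : Matrix (Fin N × Fin N) (Fin N × Fin N) A) :
    ampl2 N n M (k+1) = amp (pos3 n k h) (ampl2 N 3 M 1) := by
  rw [ampl2_eq N n (k+1) (by omega), ampl2_eq N 3 1 (by omega), amp_amp _ (pos3_inj n k h)]
  congr 1
  funext x
  fin_cases x <;> rfl

/-- L ⊗ 1 -/
def L1m (L : Matrix (Fin N) (Fin N) A) : Matrix (Fin N × Fin N) (Fin N × Fin N) A :=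
  fun p s => if p.2 = s.2 then L p.1 s.1 else 0

lemma ampl1_pair {n : ℕ} (h : 0 + 1 < n) (L : Matrix (Fin N) (Fin N) A) :
    ampl1 N n L 0 = ampl2 N n (L1m L) 0 := by
  ext i j
  simp only [ampl1, ampl2, L1m, dif_pos h, dif_pos (show 0 < n by omega)]
  by_cases h1 : ∀ m : Fin n, (m : ℕ) ≠ 0 → i m = j m
  · rw [if_pos h1, if_pos (fun m hm _ => h1 m hm), if_pos (h1 _ (by simp))]
  · rw [if_neg h1]
    split_ifs with h2 h3
    · exfalso; apply h1; intro m hm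
      by_cases hm1 : (m : ℕ) = 0 + 1
      · have : m = ⟨0 + 1, h⟩ := Fin.ext hm1
        rw [this]; exact h3
      · exact h2 m hm hm1
    all_goals rfl

lemma hyp_of (R R' : Matrix (Fin N × Fin N) (Fin N × Fin N) ℂ) (h1 : R * R' = 1) (h2 : R' * R = 1)
    (hbraid : ampl2 N 3 R 0 * ampl2 N 3 R 1 * ampl2 N 3 R 0 =
      ampl2 N 3 R 1 * ampl2 N 3 R 0 * ampl2 N 3 R 1)
    (L : Matrix (Fin N) (Fin N) A)
    (hL : R.map (algebraMap ℂ A) * L1m L * R.map (algebraMap ℂ A) * L1m L =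
        L1m L * R.map (algebraMap ℂ A) * L1m L * R.map (algebraMap ℂ A)) (n : ℕ) :
    Hyp (ampl2 N (n+1) (R.map (algebraMap ℂ A))) (ampl2 N (n+1) (R'.map (algebraMap ℂ A)))
      (ampl1 N (n+1) L 0) n where
  inv1 k hk := by
    rw [← ampl2_mul (by omega), ← Matrix.map_mul, h1, Matrix.map_one _ (map_zero _) (map_one _),
      ampl2_one (by omega)]
  inv2 k hk := by
    rw [← ampl2_mul (by omega), ← Matrix.map_mul, h2, Matrix.map_one _ (map_zero _) (map_one _),
      ampl2_one (by omega)]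
  braid k hk := by
    rw [ampl2_pos3_0 (by omega : k + 2 < n + 1), ampl2_pos3_1 (by omega : k + 2 < n + 1)]
    simp only [← amp_mul (pos3_inj _ _ _), ampl2_map, ← Matrix.map_mul, hbraid]
  far j k hjk hk := by
    rw [ampl2_eq N (n+1) k (by omega), ampl2_eq N (n+1) j (by omega)]
    refine amp_comm ?_ _ _ ?_
    · intro b c
      fin_cases b <;> fin_cases c <;> simp [pos2] <;> omega
    · intro a b c d
      exact Algebra.commutes _ _
  lcomm k hk1 hk := by
    rw [ampl2_eq N (n+1) k (by omega), ampl1_eq N (n+1) 0 (by omega)]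
    refine amp_comm ?_ _ _ ?_
    · intro b c
      fin_cases c <;> simp [pos2] <;> omega
    · intro a b c d
      exact (Algebra.commutes _ _).symm
  re hn := by
    rw [ampl1_pair (by omega)]
    simp only [← ampl2_mul (show 0 + 1 < n + 1 by omega)]
    rw [hL]

lemma bb_Lbar (n : ℕ) (R : Matrix (Fin N × Fin N) (Fin N × Fin N) ℂ) (q : ℂ)
    (L : Matrix (Fin N) (Fin N) A) (k : ℕ) :
    bb (ampl2 N n (R.map (algebraMap ℂ A))) (ampl2 N n ((R - (q - q⁻¹) • 1).map (algebraMap ℂ A)))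
      (ampl1 N n L 0) k = Lbar N n R q L k := by
  induction k with
  | zero => rfl
  | succ k ih => rw [bb, ih]; rfl

lemma emb_Lbar (n : ℕ) (R : Matrix (Fin N × Fin N) (Fin N × Fin N) ℂ) (q : ℂ)
    (L : Matrix (Fin N) (Fin N) A) (k : ℕ) (hk : k < n) :
    emb (Lbar N n R q L k) = Lbar N (n+1) R q L k := by
  induction k with
  | zero => exact emb_ampl1 _ _ hk
  | succ k ih => rw [Lbar, emb_mul, emb_mul, ih (by omega), emb_ampl2 _ _ hk, emb_ampl2 _ _ hk]; rfl

lemma emb_FF {n : ℕ} (b : ℕ → Matrix (Fin n → Fin N) (Fin n → Fin N) A)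
    (b' : ℕ → Matrix (Fin (n+1) → Fin N) (Fin (n+1) → Fin N) A) (m : ℕ)
    (h : ∀ k < m, emb (b k) = b' k) : emb (FF b m) = FF b' m := by
  induction m with
  | zero => exact emb_one
  | succ m ih => rw [FF, emb_mul, ih (fun k hk => h k (by omega)), h m (by omega), FF]

lemma emb_poly_comm {n : ℕ} (R : Matrix (Fin N × Fin N) (Fin N × Fin N) ℂ)
    (x : Matrix (Fin (n+1) → Fin N) (Fin (n+1) → Fin N) A)
    (hx : ∀ k, k + 1 < n → Commute x (ampl2 N (n+1) (R.map (algebraMap ℂ A)) k))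
    (P : Matrix (Fin n → Fin N) (Fin n → Fin N) ℂ)
    (hP : P ∈ Algebra.adjoin ℂ
      {M : Matrix (Fin n → Fin N) (Fin n → Fin N) ℂ | ∃ k : ℕ, k + 1 < n ∧ M = ampl2 N n R k}) :
    Commute x (emb (P.map (algebraMap ℂ A))) := by
  induction hP using Algebra.adjoin_induction with
  | mem P h =>
    obtain ⟨k, hk, rfl⟩ := h
    rw [← ampl2_map, emb_ampl2 _ _ hk]
    exact hx k hk
  | algebraMap c =>
    have : emb ((algebraMap ℂ (Matrix (Fin n → Fin N) (Fin n → Fin N) ℂ) c).map (algebraMap ℂ A)) =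
        algebraMap ℂ (Matrix (Fin (n+1) → Fin N) (Fin (n+1) → Fin N) A) c := by
      ext i j
      obtain ⟨i, a, rfl⟩ := sn_surj i
      obtain ⟨j, b, rfl⟩ := sn_surj j
      rw [emb_sn]
      simp only [Matrix.map_apply, Matrix.algebraMap_matrix_apply, sn_inj, Algebra.algebraMap_self,
        RingHom.id_apply]
      by_cases h1 : i = j <;> by_cases h2 : a = b <;> simp [h1, h2]
    rw [this]
    exact (Algebra.commutes c x).symm
  | add P Q _ _ h1 h2 =>
    have : emb ((P + Q).map (algebraMap ℂ A)) = emb (P.map (algebraMap ℂ A)) + emb (Q.map (algebraMap ℂ A)) := by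
      ext i j
      simp only [emb, amp, Matrix.add_apply, Matrix.map_apply]
      split_ifs <;> simp
    rw [this]
    exact h1.add_right h2
  | mul P Q _ _ h1 h2 =>
    rw [Matrix.map_mul, emb_mul]
    exact h1.mul_right h2

theorem central_gen (q : ℂ) (hq0 : q ≠ 0)
    (R : Matrix (Fin N × Fin N) (Fin N × Fin N) ℂ)
    (hbraid : ampl2 N 3 R 0 * ampl2 N 3 R 1 * ampl2 N 3 R 0 =
      ampl2 N 3 R 1 * ampl2 N 3 R 0 * ampl2 N 3 R 1)
    (hHecke : (q • (1 : Matrix (Fin N × Fin N) (Fin N × Fin N) ℂ) - R) * (q⁻¹ • 1 + R) = 0)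
    (Ψ : Matrix (Fin N × Fin N) (Fin N × Fin N) ℂ)
    (hΨ : ∀ i j k m : Fin N, ∑ a : Fin N, ∑ b : Fin N,
        R (i, b) (j, a) * Ψ (a, k) (b, m) = if i = m ∧ k = j then 1 else 0)
    (C : Matrix (Fin N) (Fin N) ℂ)
    (hC : ∀ i j : Fin N, C i j = ∑ k : Fin N, Ψ (i, k) (j, k))
    (n : ℕ)
    (P : Matrix (Fin n → Fin N) (Fin n → Fin N) ℂ)
    (hP : P ∈ Algebra.adjoin ℂ
      {M : Matrix (Fin n → Fin N) (Fin n → Fin N) ℂ | ∃ k : ℕ, k + 1 < n ∧ M = ampl2 N n R k})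
    (L : Matrix (Fin N) (Fin N) A)
    (hL : R.map (algebraMap ℂ A) * L1m L * R.map (algebraMap ℂ A) * L1m L =
        L1m L * R.map (algebraMap ℂ A) * L1m L * R.map (algebraMap ℂ A)) (x y : Fin N) :
    L x y * trRn N n C (Ltot N n R q L * P.map (algebraMap ℂ A)) =
      trRn N n C (Ltot N n R q L * P.map (algebraMap ℂ A)) * L x y := by
  set R' : Matrix (Fin N × Fin N) (Fin N × Fin N) ℂ := R - (q - q⁻¹) • 1 with hR'
  have hexp : (q • (1 : Matrix (Fin N × Fin N) (Fin N × Fin N) ℂ) - R) * (q⁻¹ • 1 + R) = 1 - R * R' := by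
    rw [hR']
    simp only [sub_mul, mul_add, mul_sub, smul_mul_assoc, mul_smul_comm, one_mul, mul_one, sub_smul,
      smul_add, smul_sub, smul_smul, mul_inv_cancel₀ hq0, inv_mul_cancel₀ hq0, one_smul]
    abel
  have h1 : R * R' = 1 := by
    rw [hexp] at hHecke
    exact (sub_eq_zero.mp hHecke).symm
  have h2 : R' * R = 1 := mul_eq_one_comm.mp h1
  have H := hyp_of R R' h1 h2 hbraid L hL n
  have i0 : ampl2 N 3 R 0 * ampl2 N 3 R' 0 = 1 := by
    rw [← ampl2_mul (by omega), h1, ampl2_one (by omega)]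
  have i0' : ampl2 N 3 R' 0 * ampl2 N 3 R 0 = 1 := by
    rw [← ampl2_mul (by omega), h2, ampl2_one (by omega)]
  have i1 : ampl2 N 3 R 1 * ampl2 N 3 R' 1 = 1 := by
    rw [← ampl2_mul (by omega), h1, ampl2_one (by omega)]
  have i1' : ampl2 N 3 R' 1 * ampl2 N 3 R 1 = 1 := by
    rw [← ampl2_mul (by omega), h2, ampl2_one (by omega)]
  have hb1 : ampl2 N 3 R 1 * ampl2 N 3 R 0 * ampl2 N 3 R' 1 =
      ampl2 N 3 R' 0 * ampl2 N 3 R 1 * ampl2 N 3 R 0 := by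
    generalize ampl2 N 3 R 0 = a at *
    generalize ampl2 N 3 R 1 = b at *
    generalize ampl2 N 3 R' 0 = a' at *
    generalize ampl2 N 3 R' 1 = b' at *
    calc b * a * b' = (a' * a) * (b * a * b') := by rw [i0', one_mul]
      _ = a' * (a * b * a) * b' := by simp only [mul_assoc]
      _ = a' * b * a * (b * b') := by rw [hbraid]; simp only [mul_assoc]
      _ = _ := by rw [i1, mul_one]
  have hb2 : ampl2 N 3 R' 1 * ampl2 N 3 R 0 * ampl2 N 3 R 1 =
      ampl2 N 3 R 0 * ampl2 N 3 R 1 * ampl2 N 3 R' 0 := by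
    generalize ampl2 N 3 R 0 = a at *
    generalize ampl2 N 3 R 1 = b at *
    generalize ampl2 N 3 R' 0 = a' at *
    generalize ampl2 N 3 R' 1 = b' at *
    calc b' * a * b = (b' * a * b) * (a * a') := by rw [i0, mul_one]
      _ = b' * (a * b * a) * a' := by simp only [mul_assoc]
      _ = (b' * b) * (a * b * a') := by rw [hbraid]; simp only [mul_assoc]
      _ = _ := by rw [i1', one_mul]
  have k1 := key_id R R R' Ψ C hb1 h2 hΨ hC
  have k2 := key_id R R' R Ψ C hb2 h1 hΨ hC
  have E := H.main (emb (P.map (algebraMap ℂ A)))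
    (emb_poly_comm R _ (fun k hk => (H.gen k hk).1) P hP)
    (emb_poly_comm R _ (fun k hk => (H.gen k hk).2) P hP)
  have eF : emb (Ltot N n R q L) = FF (bb (ampl2 N (n+1) (R.map (algebraMap ℂ A)))
      (ampl2 N (n+1) (R'.map (algebraMap ℂ A))) (ampl1 N (n+1) L 0)) n := by
    rw [Ltot, ← FF_eq]
    refine emb_FF _ _ n fun k hk => ?_
    rw [hR', bb_Lbar, emb_Lbar _ _ _ _ _ hk]
  rw [← eF, ← emb_mul] at E
  have E2 := congrArg (tau C n) E
  rw [tau_left, tau_right, tau_conj C R R' k1, tau_conj C R' R k2] at E2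
  have E3 := congrFun (congrFun E2 x) y
  rw [Matrix.mul_diagonal, Matrix.diagonal_mul] at E3
  exact E3

end Final

end St5

/-- for any polynomial P in R₁,…,R_{n−1}, the element
Tr_{R(1…n)}( L_{\bar{1→n}} · P ) is central in the RE algebra L(R). -/
theorem statement_5 (N : ℕ) (hN : 1 ≤ N) (q : ℂ) (hq0 : q ≠ 0) (hq1 : q ≠ 1) (hqm1 : q ≠ -1)
    (R : Matrix (Fin N × Fin N) (Fin N × Fin N) ℂ)
    (hbraid : ampl2 N 3 R 0 * ampl2 N 3 R 1 * ampl2 N 3 R 0 =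
      ampl2 N 3 R 1 * ampl2 N 3 R 0 * ampl2 N 3 R 1)
    (hHecke : (q • (1 : Matrix (Fin N × Fin N) (Fin N × Fin N) ℂ) - R) * (q⁻¹ • 1 + R) = 0)
    (Ψ : Matrix (Fin N × Fin N) (Fin N × Fin N) ℂ)
    (hΨ : ∀ i j k m : Fin N, ∑ a : Fin N, ∑ b : Fin N,
        R (i, b) (j, a) * Ψ (a, k) (b, m) = if i = m ∧ k = j then 1 else 0)
    (C : Matrix (Fin N) (Fin N) ℂ)
    (hC : ∀ i j : Fin N, C i j = ∑ k : Fin N, Ψ (i, k) (j, k))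
    (n : ℕ) (hn : 1 ≤ n)
    (P : Matrix (Fin n → Fin N) (Fin n → Fin N) ℂ)
    (hP : P ∈ Algebra.adjoin ℂ
      {M : Matrix (Fin n → Fin N) (Fin n → Fin N) ℂ | ∃ k : ℕ, k + 1 < n ∧ M = ampl2 N n R k}) :
    ∀ x : REA N R,
      trRn N n C (Ltot N n R q (Lgen N R) * P.map (algebraMap ℂ (REA N R))) * x =
        x * trRn N n C (Ltot N n R q (Lgen N R) * P.map (algebraMap ℂ (REA N R))) := by
  have hmap : ∀ M : Matrix (Fin N × Fin N) (Fin N × Fin N) ℂ,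
      (M.map (algebraMap ℂ (FreeAlgebra ℂ (Fin N × Fin N)))).map (RingQuot.mkAlgHom ℂ (REArel N R)) =
        M.map (algebraMap ℂ (REA N R)) := by
    intro M
    ext i j
    simp only [Matrix.map_apply]
    exact AlgHom.commutes _ _
  have hL1 : (L1F N).map (RingQuot.mkAlgHom ℂ (REArel N R)) = St5.L1m (Lgen N R) := by
    ext p s
    simp only [Matrix.map_apply, L1F, St5.L1m, Lgen]
    split_ifs <;> simp
  have hL : R.map (algebraMap ℂ (REA N R)) * St5.L1m (Lgen N R) * R.map (algebraMap ℂ (REA N R)) *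
        St5.L1m (Lgen N R) =
      St5.L1m (Lgen N R) * R.map (algebraMap ℂ (REA N R)) * St5.L1m (Lgen N R) *
        R.map (algebraMap ℂ (REA N R)) := by
    rw [← hL1, ← hmap R]
    simp only [← Matrix.map_mul]
    ext p s
    exact RingQuot.mkAlgHom_rel ℂ (REArel.rel p s)
  have key := St5.central_gen q hq0 R hbraid hHecke Ψ hΨ C hC n P hP (Lgen N R) hL
  generalize trRn N n C (Ltot N n R q (Lgen N R) * P.map (algebraMap ℂ (REA N R))) = z at key
  intro x
  obtain ⟨y, rfl⟩ := RingQuot.mkAlgHom_surjective ℂ (REArel N R) x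
  change Commute z _
  induction y using FreeAlgebra.induction with
  | grade0 c =>
    rw [AlgHom.commutes]
    exact (Algebra.commutes c z).symm
  | grade1 p => exact (key p.1 p.2).symm
  | mul a b ha hb => rw [map_mul]; exact ha.mul_right hb
  | add a b ha hb => rw [map_add]; exact ha.add_right hb
end

section
/- Let R be a skew-invertible involutive symmetry on V = ℂ^N, i.e., R satisfies the braid relation and R² = I, and let L(R) be the associated reflection equation algebra with generating matrix L. For every n ≥ 1 and every matrix P ∈ End(V^{⊗n}) that is a (noncommutative) polynomial with complex coefficients in the operators R₁, …, R_{n−1}, the element Tr_{R(1…n)}( L_{\bar{1→n}} · P ) is central in L(R). -/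
open scoped BigOperators

/-- For an involutive symmetry (R⁻¹ = R): L_{\bar 1} = L₁, L_{\bar k} = R_{k−1} L_{\overline{k−1}} R_{k−1}. -/
noncomputable def LbarInv {A : Type*} [Ring A] [Algebra ℂ A] (N n : ℕ)
    (R : Matrix (Fin N × Fin N) (Fin N × Fin N) ℂ)
    (L : Matrix (Fin N) (Fin N) A) : ℕ → Matrix (Fin n → Fin N) (Fin n → Fin N) A
  | 0 => ampl1 N n L 0
  | k + 1 =>
      ampl2 N n (R.map (algebraMap ℂ A)) k * LbarInv N n R L k *
        ampl2 N n (R.map (algebraMap ℂ A)) k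

/-- The ordered product L_{\bar 1} ⋯ L_{\bar n} in the involutive case. -/
noncomputable def LtotInv {A : Type*} [Ring A] [Algebra ℂ A] (N n : ℕ)
    (R : Matrix (Fin N × Fin N) (Fin N × Fin N) ℂ)
    (L : Matrix (Fin N) (Fin N) A) : Matrix (Fin n → Fin N) (Fin n → Fin N) A :=
  ((List.range n).map (LbarInv N n R L)).prod


section Abstract

variable {B : Type*} [Ring B]

/-- The ordered product `r 0 * ⋯ * r (m-1)`. -/
def upU (r : ℕ → B) : ℕ → B
  | 0 => 1
  | m + 1 => upU r m * r m

/-- The reversed product `r (m-1) * ⋯ * r 0`. -/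
def dnU (r : ℕ → B) : ℕ → B
  | 0 => 1
  | m + 1 => r m * dnU r m

/-- The abstract version of `LbarInv`. -/
def lbA (r : ℕ → B) (l : B) : ℕ → B
  | 0 => l
  | k + 1 => r k * lbA r l k * r k

variable {r : ℕ → B} {l : B}

lemma upU_comm (hc : ∀ k m, k + 1 < m → r k * r m = r m * r k) (m k : ℕ) (h : m < k) :
    upU r m * r k = r k * upU r m := by
  induction m with
  | zero => simp [upU]
  | succ m ih =>
    rw [upU, mul_assoc, hc m k h, ← mul_assoc, ih (by omega), mul_assoc]

lemma dnU_comm (hc : ∀ k m, k + 1 < m → r k * r m = r m * r k) (m k : ℕ) (h : m < k) :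
    r k * dnU r m = dnU r m * r k := by
  induction m with
  | zero => simp [dnU]
  | succ m ih =>
    rw [dnU, ← mul_assoc, ← hc m k h, mul_assoc, ih (by omega), mul_assoc]

lemma upU_shift (hb : ∀ k, r k * r (k+1) * r k = r (k+1) * r k * r (k+1))
    (hc : ∀ k m, k + 1 < m → r k * r m = r m * r k) (m k : ℕ) (h : k + 1 < m) :
    upU r m * r k = r (k+1) * upU r m := by
  induction m with
  | zero => omega
  | succ m ih =>
    rcases Nat.lt_or_ge (k+1) m with h1 | h1
    · rw [upU, mul_assoc, ← hc k m h1, ← mul_assoc, ih h1, mul_assoc]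
    · obtain rfl : m = k + 1 := by omega
      rw [upU, upU]
      calc upU r k * r k * r (k+1) * r k = upU r k * (r k * r (k+1) * r k) := by noncomm_ring
        _ = (upU r k * r (k+1)) * r k * r (k+1) := by rw [hb]; noncomm_ring
        _ = _ := by rw [upU_comm hc k (k+1) (by omega)]; noncomm_ring

lemma dnU_shift (hb : ∀ k, r k * r (k+1) * r k = r (k+1) * r k * r (k+1))
    (hc : ∀ k m, k + 1 < m → r k * r m = r m * r k) (m k : ℕ) (h : k + 1 < m) :
    r k * dnU r m = dnU r m * r (k+1) := by
  induction m with
  | zero => omega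
  | succ m ih =>
    rcases Nat.lt_or_ge (k+1) m with h1 | h1
    · rw [dnU, ← mul_assoc, hc k m h1, mul_assoc, ih h1, mul_assoc]
    · obtain rfl : m = k + 1 := by omega
      rw [dnU, dnU]
      calc r k * (r (k+1) * (r k * dnU r k)) = (r k * r (k+1) * r k) * dnU r k := by noncomm_ring
        _ = r (k+1) * r k * (r (k+1) * dnU r k) := by rw [hb]; noncomm_ring
        _ = _ := by rw [dnU_comm hc k (k+1) (by omega)]; noncomm_ring

lemma upU_dnU (n : ℕ) (hs : ∀ k < n, r k * r k = 1) (m : ℕ) (hm : m ≤ n) :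
    upU r m * dnU r m = 1 := by
  induction m with
  | zero => simp [upU, dnU]
  | succ m ih =>
    rw [upU, dnU, mul_assoc, ← mul_assoc (r m), hs m (by omega), one_mul, ih (by omega)]

lemma dnU_upU (n : ℕ) (hs : ∀ k < n, r k * r k = 1) (m : ℕ) (hm : m ≤ n) :
    dnU r m * upU r m = 1 := by
  induction m with
  | zero => simp [upU, dnU]
  | succ m ih =>
    rw [upU, dnU, mul_assoc, ← mul_assoc (dnU r m), ih (by omega), one_mul, hs m (by omega)]

lemma lbA_shift (n : ℕ) (hs : ∀ k < n, r k * r k = 1)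
    (hb : ∀ k, r k * r (k+1) * r k = r (k+1) * r k * r (k+1))
    (hc : ∀ k m, k + 1 < m → r k * r m = r m * r k)
    (hl : ∀ k, 1 ≤ k → Commute l (r k)) (k m : ℕ) (hm : m ≤ n) (h : k < m) :
    upU r m * lbA r l k * dnU r m = lbA r l (k+1) := by
  induction k with
  | zero =>
    rcases m with _ | m
    · omega
    clear h
    induction m with
    | zero => simp [upU, dnU, lbA]
    | succ m ih =>
      rw [← ih (by omega)]
      rw [upU, dnU]
      simp only [lbA]
      calc _ = upU r (m+1) * (r (m+1) * l) * r (m+1) * dnU r (m+1) := by noncomm_ring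
        _ = upU r (m+1) * l * (r (m+1) * r (m+1)) * dnU r (m+1) := by
          rw [← (hl (m+1) (by omega)).eq]; noncomm_ring
        _ = _ := by rw [hs _ (by omega), mul_one]
  | succ k ih =>
    rw [lbA]
    calc _ = (upU r m * r k) * lbA r l k * (r k * dnU r m) := by noncomm_ring
      _ = r (k+1) * (upU r m * lbA r l k * dnU r m) * r (k+1) := by
        rw [upU_shift hb hc m k h, dnU_shift hb hc m k h]; noncomm_ring
      _ = _ := by rw [ih (by omega)]; rfl

lemma lbA_comm (hl : ∀ k, 1 ≤ k → Commute l (r k)) (h0 : Commute l (r 0 * l * r 0)) (k : ℕ) :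
    Commute l (lbA r l (k+1)) := by
  induction k with
  | zero => exact h0
  | succ k ih =>
    rw [lbA]
    exact ((hl _ (by omega)).mul_right ih).mul_right (hl _ (by omega))

end Abstract

section Emb

variable {A : Type*} [Ring A]

/-- Splitting off the last tensor position. -/
def lastEq (N n : ℕ) : (Fin (n+1) → Fin N) ≃ (Fin n → Fin N) × Fin N where
  toFun f := (fun i => f i.castSucc, f (Fin.last n))
  invFun p := Fin.snoc (α := fun _ => Fin N) p.1 p.2
  left_inv f := by
    ext i; refine Fin.lastCases ?_ (fun i => ?_) i <;> simp
  right_inv p := by simp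

/-- Splitting off the first tensor position. -/
def firstEq (N n : ℕ) : (Fin (n+1) → Fin N) ≃ (Fin n → Fin N) × Fin N where
  toFun f := (fun i => f i.succ, f 0)
  invFun p := Fin.cons (α := fun _ => Fin N) p.2 p.1
  left_inv f := by
    ext i; refine Fin.cases ?_ (fun i => ?_) i <;> simp
  right_inv p := by simp

/-- Embedding of matrices `X ↦ X ⊗ I` along an equivalence. -/
def embG {α β γ : Type*} [Fintype α] [Fintype β] [Fintype γ] [DecidableEq α] [DecidableEq β]
    [DecidableEq γ] (e : β ≃ α × γ) : Matrix α α A →+* Matrix β β A where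
  toFun X := (Matrix.blockDiagonal (fun _ : γ => X)).submatrix e e
  map_one' := by
    have : (Matrix.blockDiagonal fun _ : γ => (1 : Matrix α α A)) = 1 := Matrix.blockDiagonal_one
    simp [this]
  map_mul' X Y := by
    rw [Matrix.submatrix_mul_equiv, ← Matrix.blockDiagonal_mul]
  map_zero' := by
    have : (Matrix.blockDiagonal fun _ : γ => (0 : Matrix α α A)) = 0 := Matrix.blockDiagonal_zero
    simp [this]
  map_add' X Y := by
    have := Matrix.blockDiagonal_add (fun _ : γ => X) (fun _ : γ => Y)
    ext i j
    exact congrFun (congrFun this (e i)) (e j)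

/-- `X ↦ X ⊗ I`. -/
def embE (N n : ℕ) : Matrix (Fin n → Fin N) (Fin n → Fin N) A →+*
    Matrix (Fin (n+1) → Fin N) (Fin (n+1) → Fin N) A := embG (lastEq N n)

/-- `X ↦ I ⊗ X`. -/
def embD (N n : ℕ) : Matrix (Fin n → Fin N) (Fin n → Fin N) A →+*
    Matrix (Fin (n+1) → Fin N) (Fin (n+1) → Fin N) A := embG (firstEq N n)

lemma embE_apply (N n : ℕ) (X : Matrix (Fin n → Fin N) (Fin n → Fin N) A)
    (i j : Fin (n+1) → Fin N) : embE N n X i j =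
      if i (Fin.last n) = j (Fin.last n) then
        X (fun k => i k.castSucc) (fun k => j k.castSucc) else 0 := by
  simp [embE, embG, Matrix.blockDiagonal_apply, lastEq]

lemma embD_apply (N n : ℕ) (X : Matrix (Fin n → Fin N) (Fin n → Fin N) A)
    (i j : Fin (n+1) → Fin N) : embD N n X i j =
      if i 0 = j 0 then X (fun k => i k.succ) (fun k => j k.succ) else 0 := by
  simp [embD, embG, Matrix.blockDiagonal_apply, firstEq]

lemma embE_ampl2 (N n k : ℕ) (M : Matrix (Fin N × Fin N) (Fin N × Fin N) A) (h : k + 1 < n) :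
    embE N n (ampl2 N n M k) = ampl2 N (n+1) M k := by
  ext i j
  rw [embE_apply]
  unfold ampl2
  rw [dif_pos h, dif_pos (by omega : k + 1 < n + 1)]
  have : (∀ m : Fin (n+1), (m : ℕ) ≠ k → (m : ℕ) ≠ k + 1 → i m = j m) ↔
      (i (Fin.last n) = j (Fin.last n) ∧ ∀ m : Fin n, (m : ℕ) ≠ k → (m : ℕ) ≠ k + 1 →
        i m.castSucc = j m.castSucc) := by
    rw [Fin.forall_fin_succ']
    simp only [Fin.val_castSucc, Fin.val_last]
    constructor
    · rintro ⟨a, b⟩; exact ⟨b (by omega) (by omega), a⟩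
    · rintro ⟨a, b⟩; exact ⟨b, fun _ _ => a⟩
  simp only [this, ite_and]
  rfl

lemma embE_ampl1 (N n k : ℕ) (M : Matrix (Fin N) (Fin N) A) (h : k < n) :
    embE N n (ampl1 N n M k) = ampl1 N (n+1) M k := by
  ext i j
  rw [embE_apply]
  unfold ampl1
  rw [dif_pos h, dif_pos (by omega : k < n + 1)]
  have : (∀ m : Fin (n+1), (m : ℕ) ≠ k → i m = j m) ↔
      (i (Fin.last n) = j (Fin.last n) ∧ ∀ m : Fin n, (m : ℕ) ≠ k →
        i m.castSucc = j m.castSucc) := by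
    rw [Fin.forall_fin_succ']
    simp only [Fin.val_castSucc, Fin.val_last]
    constructor
    · rintro ⟨a, b⟩; exact ⟨b (by omega), a⟩
    · rintro ⟨a, b⟩; exact ⟨b, fun _ => a⟩
  simp only [this, ite_and]
  rfl

lemma embD_ampl2 (N n k : ℕ) (M : Matrix (Fin N × Fin N) (Fin N × Fin N) A) :
    embD N n (ampl2 N n M k) = ampl2 N (n+1) M (k+1) := by
  ext i j
  rw [embD_apply]
  unfold ampl2
  by_cases h : k + 1 < n
  · rw [dif_pos h, dif_pos (by omega : k + 1 + 1 < n + 1)]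
    have : (∀ m : Fin (n+1), (m : ℕ) ≠ k + 1 → (m : ℕ) ≠ k + 1 + 1 → i m = j m) ↔
        (i 0 = j 0 ∧ ∀ m : Fin n, (m : ℕ) ≠ k → (m : ℕ) ≠ k + 1 →
          i m.succ = j m.succ) := by
      rw [Fin.forall_fin_succ]
      simp
    simp only [this, ite_and]
    rfl
  · rw [dif_neg h, dif_neg (by omega)]; simp

lemma ampl2_out (N n k : ℕ) (M : Matrix (Fin N × Fin N) (Fin N × Fin N) A) (h : ¬ k + 1 < n) :
    ampl2 N n M k = 0 := by
  ext i j; simp [ampl2, h]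

/-- the two-site index equivalence -/
def twoEq (N : ℕ) : (Fin 2 → Fin N) ≃ Fin N × Fin N where
  toFun f := (f 0, f 1)
  invFun p := ![p.1, p.2]
  left_inv f := by ext i; fin_cases i <;> rfl
  right_inv p := rfl

lemma ampl2_two (N : ℕ) (M : Matrix (Fin N × Fin N) (Fin N × Fin N) A) :
    ampl2 N 2 M 0 = M.submatrix (twoEq N) (twoEq N) := by
  ext i j
  simp [ampl2, Fin.forall_fin_two]
  rfl

lemma ampl2_sq (N : ℕ) (M : Matrix (Fin N × Fin N) (Fin N × Fin N) A) (h : M * M = 1)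
    (n k : ℕ) (hk : k + 1 < n) : ampl2 N n M k * ampl2 N n M k = 1 := by
  induction k generalizing n with
  | zero =>
    obtain ⟨n, rfl⟩ : ∃ m, n = m + 2 := ⟨n - 2, by omega⟩
    clear hk
    induction n with
    | zero => rw [ampl2_two, Matrix.submatrix_mul_equiv, h]; simp
    | succ n ih =>
      rw [← embE_ampl2 N (n+2) 0 M (by omega), ← map_mul, ih, map_one]
  | succ k ih =>
    obtain ⟨n, rfl⟩ : ∃ m, n = m + 1 := ⟨n - 1, by omega⟩
    rw [← embD_ampl2, ← map_mul, ih n (by omega), map_one]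

lemma ampl2_braid (N : ℕ) (M : Matrix (Fin N × Fin N) (Fin N × Fin N) A)
    (h : ampl2 N 3 M 0 * ampl2 N 3 M 1 * ampl2 N 3 M 0 =
      ampl2 N 3 M 1 * ampl2 N 3 M 0 * ampl2 N 3 M 1)
    (n k : ℕ) : ampl2 N n M k * ampl2 N n M (k+1) * ampl2 N n M k =
      ampl2 N n M (k+1) * ampl2 N n M k * ampl2 N n M (k+1) := by
  by_cases hk : k + 2 < n
  swap
  · rw [ampl2_out N n (k+1) M (by omega)]; simp
  induction k generalizing n with
  | zero =>
    obtain ⟨n, rfl⟩ : ∃ m, n = m + 3 := ⟨n - 3, by omega⟩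
    clear hk
    induction n with
    | zero => exact h
    | succ n ih =>
      rw [← embE_ampl2 N (n+3) 0 M (by omega), ← embE_ampl2 N (n+3) (0+1) M (by omega)]
      simp only [← map_mul, ih]
  | succ k ih =>
    obtain ⟨n, rfl⟩ : ∃ m, n = m + 1 := ⟨n - 1, by omega⟩
    rw [← embD_ampl2, ← embD_ampl2]
    simp only [← map_mul]
    rw [ih n (by omega)]

/-- entries of the operator acting in the last two positions -/
lemma ampl2_last (N n : ℕ) (M : Matrix (Fin N × Fin N) (Fin N × Fin N) A)
    (i j : Fin (n+2) → Fin N) : ampl2 N (n+2) M n i j =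
      if (fun k : Fin n => i k.castSucc.castSucc) = (fun k : Fin n => j k.castSucc.castSucc) then
        M (i (Fin.last n).castSucc, i (Fin.last (n+1)))
          (j (Fin.last n).castSucc, j (Fin.last (n+1))) else 0 := by
  unfold ampl2
  rw [dif_pos (by omega)]
  have : (∀ m : Fin (n+2), (m : ℕ) ≠ n → (m : ℕ) ≠ n + 1 → i m = j m) ↔
      (fun k : Fin n => i k.castSucc.castSucc) = (fun k : Fin n => j k.castSucc.castSucc) := by
    rw [funext_iff, Fin.forall_fin_succ', Fin.forall_fin_succ']
    simp only [Fin.val_castSucc, Fin.val_last]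
    constructor
    · rintro ⟨⟨a, -⟩, -⟩ x; exact a x (by omega) (by omega)
    · intro a; exact ⟨⟨fun x _ _ => a x, by simp⟩, by simp⟩
  simp only [this]
  rfl

/-- splitting sums over the last index -/
lemma sum_last (N n : ℕ) {B : Type*} [AddCommMonoid B] (f : (Fin (n+1) → Fin N) → B) :
    ∑ i, f i = ∑ i : Fin n → Fin N, ∑ a : Fin N, f ((lastEq N n).symm (i, a)) := by
  rw [← (lastEq N n).symm.sum_comp, Fintype.sum_prod_type]

lemma sn_cast (N n : ℕ) (i : Fin n → Fin N) (a : Fin N) (k : Fin n) :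
    (lastEq N n).symm (i, a) k.castSucc = i k := by simp [lastEq]

lemma sn_last (N n : ℕ) (i : Fin n → Fin N) (a : Fin N) :
    (lastEq N n).symm (i, a) (Fin.last n) = a := by simp [lastEq]

lemma embE_sn (N n : ℕ) (X : Matrix (Fin n → Fin N) (Fin n → Fin N) A)
    (i j : Fin n → Fin N) (a b : Fin N) :
    embE N n X ((lastEq N n).symm (i, a)) ((lastEq N n).symm (j, b)) =
      if a = b then X i j else 0 := by
  rw [embE_apply]; simp only [sn_cast, sn_last]

lemma ampl2_sn (N n : ℕ) (M : Matrix (Fin N × Fin N) (Fin N × Fin N) A)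
    (i j : Fin n → Fin N) (a b c d : Fin N) :
    ampl2 N (n+2) M n ((lastEq N (n+1)).symm ((lastEq N n).symm (i, a), b))
      ((lastEq N (n+1)).symm ((lastEq N n).symm (j, c), d)) =
      if i = j then M (a, b) (c, d) else 0 := by
  rw [ampl2_last]; simp only [sn_cast, sn_last]

lemma ext_sn {B : Type*} (N n : ℕ) {X Y : Matrix (Fin (n+1) → Fin N) (Fin (n+1) → Fin N) B}
    (h : ∀ i j a b, X ((lastEq N n).symm (i, a)) ((lastEq N n).symm (j, b)) =
      Y ((lastEq N n).symm (i, a)) ((lastEq N n).symm (j, b))) : X = Y := by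
  ext i j
  obtain ⟨⟨i, a⟩, rfl⟩ := (lastEq N n).symm.surjective i
  obtain ⟨⟨j, b⟩, rfl⟩ := (lastEq N n).symm.surjective j
  exact h i j a b

lemma last_comm [Algebra ℂ A] (N n : ℕ) (R : Matrix (Fin N × Fin N) (Fin N × Fin N) ℂ)
    (X : Matrix (Fin n → Fin N) (Fin n → Fin N) A) :
    embE N (n+1) (embE N n X) * ampl2 N (n+2) (R.map (algebraMap ℂ A)) n =
      ampl2 N (n+2) (R.map (algebraMap ℂ A)) n * embE N (n+1) (embE N n X) := by
  refine ext_sn N (n+1) fun i j a b => ?_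
  obtain ⟨⟨i, a'⟩, rfl⟩ := (lastEq N n).symm.surjective i
  obtain ⟨⟨j, b'⟩, rfl⟩ := (lastEq N n).symm.surjective j
  simp only [Matrix.mul_apply, sum_last, embE_sn, ampl2_sn]
  simp [Algebra.commutes]

lemma ampl2_comm [Algebra ℂ A] (N : ℕ) (R : Matrix (Fin N × Fin N) (Fin N × Fin N) ℂ)
    (n k m : ℕ) (h : k + 1 < m) :
    ampl2 N n (R.map (algebraMap ℂ A)) k * ampl2 N n (R.map (algebraMap ℂ A)) m =
      ampl2 N n (R.map (algebraMap ℂ A)) m * ampl2 N n (R.map (algebraMap ℂ A)) k := by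
  induction n with
  | zero => rw [ampl2_out N 0 k _ (by omega)]; simp
  | succ n ih =>
    rcases Nat.lt_trichotomy (m + 1) n with h1 | h1 | h1
    · rw [← embE_ampl2 N n k _ (by omega), ← embE_ampl2 N n m _ (by omega), ← map_mul, ih,
        map_mul]
    · subst h1
      rw [← embE_ampl2 N (m+1) k _ (by omega), ← embE_ampl2 N m k _ (by omega)]
      exact last_comm N m R _
    · rw [ampl2_out N (n+1) m _ (by omega)]; simp

lemma ampl1_comm [Algebra ℂ A] (N : ℕ) (R : Matrix (Fin N × Fin N) (Fin N × Fin N) ℂ)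
    (L : Matrix (Fin N) (Fin N) A) (n k : ℕ) (hk : 1 ≤ k) :
    Commute (ampl1 N n L 0) (ampl2 N n (R.map (algebraMap ℂ A)) k) := by
  induction n with
  | zero => rw [ampl2_out N 0 k _ (by omega)]; simp
  | succ n ih =>
    rcases Nat.lt_trichotomy (k + 1) n with h1 | h1 | h1
    · rw [← embE_ampl2 N n k _ (by omega), ← embE_ampl1 N n 0 _ (by omega)]
      exact ih.map _
    · subst h1
      rw [← embE_ampl1 N (k+1) 0 _ (by omega), ← embE_ampl1 N k 0 _ (by omega)]
      exact last_comm N k R _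
    · rw [ampl2_out N (n+1) k _ (by omega)]; simp

/-- `L ⊗ I` on two sites. -/
def L1A (N : ℕ) (L : Matrix (Fin N) (Fin N) A) :
    Matrix (Fin N × Fin N) (Fin N × Fin N) A :=
  fun p r => if p.2 = r.2 then L p.1 r.1 else 0

lemma ampl1_two (N : ℕ) (L : Matrix (Fin N) (Fin N) A) :
    ampl1 N 2 L 0 = (L1A N L).submatrix (twoEq N) (twoEq N) := by
  ext i j
  simp [ampl1, L1A, Fin.forall_fin_two]
  rfl

lemma ampl1_re (N : ℕ) (R : Matrix (Fin N × Fin N) (Fin N × Fin N) A)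
    (L : Matrix (Fin N) (Fin N) A)
    (h : R * L1A N L * R * L1A N L = L1A N L * R * L1A N L * R) (n : ℕ) :
    Commute (ampl1 N n L 0) (ampl2 N n R 0 * ampl1 N n L 0 * ampl2 N n R 0) := by
  by_cases hn : 1 < n
  swap
  · rw [ampl2_out N n 0 _ (by omega)]; simp
  obtain ⟨n, rfl⟩ : ∃ m, n = m + 2 := ⟨n - 2, by omega⟩
  clear hn
  induction n with
  | zero =>
    rw [ampl1_two, ampl2_two]
    simp only [Commute, SemiconjBy, Matrix.submatrix_mul_equiv, h, ← mul_assoc]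
  | succ n ih =>
    rw [← embE_ampl2 N (n+2) 0 _ (by omega), ← embE_ampl1 N (n+2) 0 _ (by omega)]
    simp only [← map_mul]
    exact ih.map _

end Emb

section Trace

variable {A : Type*} [Ring A] [Algebra ℂ A]

/-- Partial R-trace over the last position. -/
noncomputable def ptr (N n : ℕ) (C : Matrix (Fin N) (Fin N) ℂ)
    (M : Matrix (Fin (n+1) → Fin N) (Fin (n+1) → Fin N) A) :
    Matrix (Fin n → Fin N) (Fin n → Fin N) A := fun i j =>
  ∑ a, ∑ b, C a b • M ((lastEq N n).symm (i, b)) ((lastEq N n).symm (j, a))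

lemma ptr_left (N n : ℕ) (C : Matrix (Fin N) (Fin N) ℂ)
    (X : Matrix (Fin n → Fin N) (Fin n → Fin N) A)
    (M : Matrix (Fin (n+1) → Fin N) (Fin (n+1) → Fin N) A) :
    ptr N n C (embE N n X * M) = X * ptr N n C M := by
  ext i j
  simp only [ptr, Matrix.mul_apply, sum_last, embE_sn]
  simp only [ite_mul, zero_mul, Finset.sum_ite_eq, Finset.mem_univ, if_true, Finset.smul_sum,
    Finset.mul_sum, mul_smul_comm]
  conv_rhs => rw [Finset.sum_comm]; enter [2, a]; rw [Finset.sum_comm]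

lemma ptr_right (N n : ℕ) (C : Matrix (Fin N) (Fin N) ℂ)
    (X : Matrix (Fin n → Fin N) (Fin n → Fin N) A)
    (M : Matrix (Fin (n+1) → Fin N) (Fin (n+1) → Fin N) A) :
    ptr N n C (M * embE N n X) = ptr N n C M * X := by
  ext i j
  simp only [ptr, Matrix.mul_apply, sum_last, embE_sn]
  simp only [mul_ite, mul_zero, Finset.sum_ite_eq', Finset.mem_univ, if_true, Finset.smul_sum,
    Finset.sum_mul, smul_mul_assoc]
  conv_rhs => rw [Finset.sum_comm]; enter [2, a]; rw [Finset.sum_comm]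

lemma conj_key (N n : ℕ) (R : Matrix (Fin N × Fin N) (Fin N × Fin N) ℂ)
    (X : Matrix (Fin (n+1) → Fin N) (Fin (n+1) → Fin N) A)
    (i j : Fin n → Fin N) (a b x y : Fin N) :
    (ampl2 N (n+2) (R.map (algebraMap ℂ A)) n * embE N (n+1) X *
      ampl2 N (n+2) (R.map (algebraMap ℂ A)) n)
        ((lastEq N (n+1)).symm ((lastEq N n).symm (i, a), x))
        ((lastEq N (n+1)).symm ((lastEq N n).symm (j, b), y)) =
      ∑ q, ∑ p, ∑ c, (R (a, x) (p, c) * R (q, c) (b, y)) •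
        X ((lastEq N n).symm (i, p)) ((lastEq N n).symm (j, q)) := by
  simp only [Matrix.mul_apply, sum_last, embE_sn, ampl2_sn, mul_ite, ite_mul, mul_zero, zero_mul,
    Finset.sum_ite_eq, Finset.sum_ite_eq', Finset.mem_univ, if_true, Matrix.map_apply,
    Finset.sum_ite_irrel, Finset.sum_const_zero, Finset.sum_mul]
  refine Finset.sum_congr rfl fun q _ => ?_
  rw [Finset.sum_comm]
  refine Finset.sum_congr rfl fun p _ => Finset.sum_congr rfl fun c _ => ?_
  rw [← Algebra.commutes, Algebra.smul_def, map_mul, ← mul_assoc, ← map_mul, ← map_mul, mul_comm]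

lemma ptr_conj (N n : ℕ) (C : Matrix (Fin N) (Fin N) ℂ)
    (R : Matrix (Fin N × Fin N) (Fin N × Fin N) ℂ)
    (hCR : ∀ i j p q, ∑ a, ∑ b, ∑ c, C a b * (R (i, b) (p, c) * R (q, c) (j, a)) =
      if i = j then C q p else 0)
    (X : Matrix (Fin (n+1) → Fin N) (Fin (n+1) → Fin N) A) :
    ptr N (n+1) C (ampl2 N (n+2) (R.map (algebraMap ℂ A)) n * embE N (n+1) X *
      ampl2 N (n+2) (R.map (algebraMap ℂ A)) n) = embE N n (ptr N n C X) := by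
  refine ext_sn N n fun i j a b => ?_
  rw [embE_sn]
  simp only [ptr, conj_key]
  have h2 : ∀ q p, (∑ y, ∑ x, ∑ c, C y x * (R (a, x) (p, c) * R (q, c) (b, y))) •
      X ((lastEq N n).symm (i, p)) ((lastEq N n).symm (j, q)) =
      if a = b then C q p • X ((lastEq N n).symm (i, p)) ((lastEq N n).symm (j, q)) else 0 := by
    intro q p; rw [hCR]; split_ifs <;> simp
  calc _ = ∑ q, ∑ p, (∑ y, ∑ x, ∑ c, C y x * (R (a, x) (p, c) * R (q, c) (b, y))) •
      X ((lastEq N n).symm (i, p)) ((lastEq N n).symm (j, q)) := by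
        simp only [Finset.smul_sum, Finset.sum_smul, smul_smul]
        calc _ = ∑ y, ∑ q, ∑ x, ∑ p, ∑ c, (C y x * (R (a, x) (p, c) * R (q, c) (b, y))) •
              X ((lastEq N n).symm (i, p)) ((lastEq N n).symm (j, q)) :=
              Finset.sum_congr rfl fun y _ => Finset.sum_comm
          _ = ∑ q, ∑ y, ∑ p, ∑ x, ∑ c, (C y x * (R (a, x) (p, c) * R (q, c) (b, y))) •
              X ((lastEq N n).symm (i, p)) ((lastEq N n).symm (j, q)) := by
              rw [Finset.sum_comm]
              exact Finset.sum_congr rfl fun q _ => Finset.sum_congr rfl fun y _ => Finset.sum_comm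
          _ = _ := Finset.sum_congr rfl fun q _ => Finset.sum_comm
    _ = _ := by
      simp only [h2]
      split_ifs <;> simp

lemma trRn_succ (N n : ℕ) (C : Matrix (Fin N) (Fin N) ℂ)
    (M : Matrix (Fin (n+1) → Fin N) (Fin (n+1) → Fin N) A) :
    trRn N (n+1) C M = trRn N n C (ptr N n C M) := by
  simp only [trRn, ptr, sum_last, Fin.prod_univ_castSucc, sn_cast, sn_last, Finset.mul_sum]
  refine Finset.sum_congr rfl fun i _ => ?_
  rw [Finset.sum_comm]
  refine Finset.sum_congr rfl fun j _ => Finset.sum_congr rfl fun a _ =>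
    Finset.sum_congr rfl fun b _ => ?_
  rw [map_mul, mul_assoc, Algebra.smul_def]

/-- Trace over all positions but the first. -/
noncomputable def trF (N : ℕ) (C : Matrix (Fin N) (Fin N) ℂ) : (n : ℕ) →
    Matrix (Fin (n+1) → Fin N) (Fin (n+1) → Fin N) A →
    Matrix (Fin 1 → Fin N) (Fin 1 → Fin N) A
  | 0, M => M
  | n + 1, M => trF N C n (ptr N (n+1) C M)

lemma trF_left (N n : ℕ) (C : Matrix (Fin N) (Fin N) ℂ) (L : Matrix (Fin N) (Fin N) A)
    (M : Matrix (Fin (n+1) → Fin N) (Fin (n+1) → Fin N) A) :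
    trF N C n (ampl1 N (n+1) L 0 * M) = ampl1 N 1 L 0 * trF N C n M := by
  induction n with
  | zero => rfl
  | succ n ih =>
    rw [trF, trF, ← embE_ampl1 N (n+1) 0 L (by omega), ptr_left, ih]

lemma trF_right (N n : ℕ) (C : Matrix (Fin N) (Fin N) ℂ) (L : Matrix (Fin N) (Fin N) A)
    (M : Matrix (Fin (n+1) → Fin N) (Fin (n+1) → Fin N) A) :
    trF N C n (M * ampl1 N (n+1) L 0) = trF N C n M * ampl1 N 1 L 0 := by
  induction n with
  | zero => rfl
  | succ n ih =>
    rw [trF, trF, ← embE_ampl1 N (n+1) 0 L (by omega), ptr_right, ih]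

lemma embE_upU (N n m : ℕ) (R : Matrix (Fin N × Fin N) (Fin N × Fin N) A) (h : m < n) :
    embE N n (upU (ampl2 N n R) m) = upU (ampl2 N (n+1) R) m := by
  induction m with
  | zero => simp [upU]
  | succ m ih => rw [upU, upU, map_mul, ih (by omega), embE_ampl2 N n m R (by omega)]

lemma embE_dnU (N n m : ℕ) (R : Matrix (Fin N × Fin N) (Fin N × Fin N) A) (h : m < n) :
    embE N n (dnU (ampl2 N n R) m) = dnU (ampl2 N (n+1) R) m := by
  induction m with
  | zero => simp [dnU]
  | succ m ih => rw [dnU, dnU, map_mul, ih (by omega), embE_ampl2 N n m R (by omega)]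

lemma trF_conj (N n : ℕ) (C : Matrix (Fin N) (Fin N) ℂ)
    (R : Matrix (Fin N × Fin N) (Fin N × Fin N) ℂ)
    (hCR : ∀ i j p q, ∑ a, ∑ b, ∑ c, C a b * (R (i, b) (p, c) * R (q, c) (j, a)) =
      if i = j then C q p else 0)
    (W : Matrix (Fin n → Fin N) (Fin n → Fin N) A) (i j : Fin 1 → Fin N) :
    trF N C n (upU (ampl2 N (n+1) (R.map (algebraMap ℂ A))) n * embE N n W *
      dnU (ampl2 N (n+1) (R.map (algebraMap ℂ A))) n) i j =
      if i = j then trRn N n C W else 0 := by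
  induction n with
  | zero =>
    simp only [trF, upU, dnU, one_mul, mul_one, embE_apply]
    have : i = j ↔ i (Fin.last 0) = j (Fin.last 0) := by
      constructor
      · rintro rfl; rfl
      · intro h; ext x; rw [Subsingleton.elim x (Fin.last 0), h]
    simp only [this]
    congr 1
    simp only [trRn, Finset.univ_unique, Finset.sum_singleton, Finset.univ_eq_empty,
      Finset.prod_empty, map_one, one_mul]
    congr 1 <;> exact Subsingleton.elim _ _
  | succ n ih =>
    rw [trRn_succ, ← ih, trF, upU, dnU, ← embE_upU N (n+1) n _ (by omega),
      ← embE_dnU N (n+1) n _ (by omega)]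
    congr 1
    simp only [mul_assoc]
    rw [ptr_left]
    simp only [← mul_assoc]
    rw [ptr_right, ← ptr_conj N n C R hCR]
    simp only [mul_assoc]

end Trace

section Skew

lemma skew_key (N : ℕ) (R : Matrix (Fin N × Fin N) (Fin N × Fin N) ℂ)
    (hbraid : ampl2 N 3 R 0 * ampl2 N 3 R 1 * ampl2 N 3 R 0 =
      ampl2 N 3 R 1 * ampl2 N 3 R 0 * ampl2 N 3 R 1)
    (hinv : R * R = 1)
    (Ψ : Matrix (Fin N × Fin N) (Fin N × Fin N) ℂ)
    (hΨ : ∀ i j k m : Fin N, ∑ a : Fin N, ∑ b : Fin N,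
        R (i, b) (j, a) * Ψ (a, k) (b, m) = if i = m ∧ k = j then 1 else 0)
    (C : Matrix (Fin N) (Fin N) ℂ)
    (hC : ∀ i j : Fin N, C i j = ∑ k : Fin N, Ψ (i, k) (j, k)) (i j p q : Fin N) :
    ∑ a, ∑ b, ∑ c, C a b * (R (i, b) (p, c) * R (q, c) (j, a)) =
      if i = j then C q p else 0 := by
  let S : Matrix (Fin N × Fin N) (Fin N × Fin N) ℂ := fun x y => R (x.1, y.1) (x.2, y.2)
  let T : Matrix (Fin N × Fin N) (Fin N × Fin N) ℂ := fun x y => Ψ (x.2, y.2) (x.1, y.1)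
  have hST : S * T = 1 := by
    ext ⟨x1, x2⟩ ⟨y1, y2⟩
    rw [Matrix.mul_apply, Fintype.sum_prod_type, Finset.sum_comm]
    refine (hΨ x1 x2 y2 y1).trans ?_
    rw [Matrix.one_apply]
    simp only [Prod.mk.injEq, eq_comm]
  have hTS : T * S = 1 := mul_eq_one_comm.mp hST
  have inj : ∀ v w : Fin N × Fin N → ℂ, S.mulVec v = S.mulVec w → v = w := by
    intro v w h
    have := congrArg T.mulVec h
    simpa [Matrix.mulVec_mulVec, hTS] using this
  have hRC : ∀ u v, ∑ a, ∑ b, C a b * R (u, b) (v, a) = if u = v then 1 else 0 := by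
    intro u v
    simp only [hC, Finset.sum_mul]
    calc _ = ∑ k, ∑ a, ∑ b, R (u, b) (v, a) * Ψ (a, k) (b, k) := by
          rw [Finset.sum_comm]
          conv_lhs => enter [2, b]; rw [Finset.sum_comm]
          rw [Finset.sum_comm]
          refine Finset.sum_congr rfl fun k _ => ?_
          rw [Finset.sum_comm]
          exact Finset.sum_congr rfl fun k _ => Finset.sum_congr rfl fun k _ => mul_comm _ _
      _ = _ := by
        simp only [hΨ]
        by_cases h : u = v
        · subst h; simp [ite_and]
        · rw [if_neg h]
          refine Finset.sum_eq_zero fun k _ => if_neg ?_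
          rintro ⟨rfl, rfl⟩; exact h rfl
  -- the partially traced operators
  have e0 : ampl2 N 3 R 0 = embE N 2 (ampl2 N 2 R 0) := (embE_ampl2 N 2 0 R (by omega)).symm
  have hsq : ampl2 N 2 R 0 * ampl2 N 2 R 0 = 1 := ampl2_sq N R hinv 2 0 (by omega)
  have p1 : ptr N 2 C (ampl2 N 3 R 1) = 1 := by
    refine ext_sn N 1 fun x y a b => ?_
    have : ∀ x y : Fin 1 → Fin N, ((lastEq N 1).symm (x, a) = (lastEq N 1).symm (y, b)) ↔
        (x = y ∧ a = b) := by
      intro x y; simp [Prod.ext_iff]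
    rw [Matrix.one_apply]
    simp only [ptr, ampl2_sn, this, smul_eq_mul, mul_ite, mul_zero]
    by_cases hxy : x = y
    · simp [hxy, hRC]
    · simp [hxy]
  have p2 : ptr N 2 C (ampl2 N 3 R 1 * ampl2 N 3 R 0 * ampl2 N 3 R 1) = 1 := by
    rw [← hbraid, e0, ptr_right, ptr_left, p1, mul_one, hsq]
  have main : ∀ u v, ∑ p, ∑ q, R (u, p) (v, q) *
      (∑ a, ∑ b, ∑ c, C a b * (R (i, b) (p, c) * R (q, c) (j, a))) =
      if u = v then (if i = j then 1 else 0) else 0 := by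
    intro u v
    have := congrFun (congrFun p2 ((lastEq N 1).symm (fun _ => u, i)))
      ((lastEq N 1).symm (fun _ => v, j))
    have hmap : R.map (algebraMap ℂ ℂ) = R := by ext x y; simp
    have ck := conj_key (A := ℂ) N 1 R (ampl2 N 2 R 0) (fun _ => u) (fun _ => v) i j
    rw [hmap] at ck
    have hR : ∀ p q, ampl2 N 2 R 0 ((lastEq N 1).symm (fun _ => u, p))
        ((lastEq N 1).symm (fun _ => v, q)) = R (u, p) (v, q) := by
      intro p q
      rw [ampl2_two]
      rfl
    simp only [hR] at ck
    rw [Matrix.one_apply, e0] at this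
    simp only [ptr, ck] at this
    have h3 : ((lastEq N 1).symm (fun _ => u, i) = (lastEq N 1).symm (fun _ => v, j)) ↔
        (u = v ∧ i = j) := by
      rw [EmbeddingLike.apply_eq_iff_eq, Prod.mk.injEq, funext_iff]; simp
    simp only [h3, ite_and] at this
    rw [← this]
    simp only [smul_eq_mul, Finset.mul_sum]
    calc _ = ∑ p, ∑ a, ∑ q, ∑ b, ∑ c, R (u, p) (v, q) *
            (C a b * (R (i, b) (p, c) * R (q, c) (j, a))) :=
          Finset.sum_congr rfl fun p _ => Finset.sum_comm
      _ = ∑ a, ∑ p, ∑ b, ∑ q, ∑ c, R (u, p) (v, q) *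
            (C a b * (R (i, b) (p, c) * R (q, c) (j, a))) := by
          rw [Finset.sum_comm]
          exact Finset.sum_congr rfl fun a _ => Finset.sum_congr rfl fun p _ => Finset.sum_comm
      _ = ∑ a, ∑ b, ∑ q, ∑ p, ∑ c, R (u, p) (v, q) *
            (C a b * (R (i, b) (p, c) * R (q, c) (j, a))) := by
          refine Finset.sum_congr rfl fun a _ => ?_
          rw [Finset.sum_comm]
          exact Finset.sum_congr rfl fun b _ => Finset.sum_comm
      _ = _ := by
          refine Finset.sum_congr rfl fun a _ => Finset.sum_congr rfl fun b _ =>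
            Finset.sum_congr rfl fun q _ => Finset.sum_congr rfl fun p _ =>
            Finset.sum_congr rfl fun c _ => ?_
          ring
  have fin := inj (fun x => ∑ a, ∑ b, ∑ c, C a b * (R (i, b) (x.1, c) * R (x.2, c) (j, a)))
    (fun x => if i = j then C x.2 x.1 else 0) (by
      ext ⟨u, v⟩
      simp only [Matrix.mulVec, dotProduct, Fintype.sum_prod_type, S]
      rw [main]
      by_cases h : i = j
      · simp only [h, if_true]
        rw [← hRC, Finset.sum_comm]
        exact Finset.sum_congr rfl fun _ _ => Finset.sum_congr rfl fun _ _ => mul_comm _ _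
      · simp [h])
  exact congrFun fin (p, q)

end Skew

section Main

lemma embE_LbarInv {A : Type*} [Ring A] [Algebra ℂ A] (N n k : ℕ)
    (R : Matrix (Fin N × Fin N) (Fin N × Fin N) ℂ) (L : Matrix (Fin N) (Fin N) A) (h : k < n) :
    embE N n (LbarInv N n R L k) =
      lbA (ampl2 N (n+1) (R.map (algebraMap ℂ A))) (ampl1 N (n+1) L 0) k := by
  induction k with
  | zero => rw [LbarInv, lbA, embE_ampl1 N n 0 L h]
  | succ k ih =>
    rw [LbarInv, lbA, map_mul, map_mul, ih (by omega), embE_ampl2 N n k _ h]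

lemma ampl2_map {A : Type*} [Ring A] [Algebra ℂ A] (N n k : ℕ)
    (R : Matrix (Fin N × Fin N) (Fin N × Fin N) ℂ) :
    ampl2 N n (R.map (algebraMap ℂ A)) k = (ampl2 N n R k).map (algebraMap ℂ A) := by
  ext i j
  simp only [ampl2, Matrix.map_apply]
  split_ifs <;> simp

lemma Lgen_rel (N : ℕ) (R : Matrix (Fin N × Fin N) (Fin N × Fin N) ℂ) :
    R.map (algebraMap ℂ (REA N R)) * L1A N (Lgen N R) * R.map (algebraMap ℂ (REA N R)) *
      L1A N (Lgen N R) = L1A N (Lgen N R) * R.map (algebraMap ℂ (REA N R)) * L1A N (Lgen N R) *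
      R.map (algebraMap ℂ (REA N R)) := by
  have h1 : L1A N (Lgen N R) = (L1F N).map (RingQuot.mkAlgHom ℂ (REArel N R)) := by
    ext p r
    simp only [L1A, L1F, Lgen, Matrix.map_apply]
    split_ifs <;> simp
  have h2 : R.map (algebraMap ℂ (REA N R)) =
      (R.map (algebraMap ℂ (FreeAlgebra ℂ (Fin N × Fin N)))).map
        (RingQuot.mkAlgHom ℂ (REArel N R)) := by
    ext p r
    simp only [Matrix.map_apply, AlgHom.commutes]
  rw [h1, h2]
  simp only [← Matrix.map_mul]
  ext p r
  exact RingQuot.mkAlgHom_rel ℂ (REArel.rel p r)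

end Main

/-- for a skew-invertible involutive symmetry R (R² = I), the element
Tr_{R(1…n)}( L_{\bar{1→n}} · P ) is central in L(R) for any polynomial P in R₁,…,R_{n−1}. -/
theorem statement_6 (N : ℕ) (hN : 1 ≤ N)
    (R : Matrix (Fin N × Fin N) (Fin N × Fin N) ℂ)
    (hbraid : ampl2 N 3 R 0 * ampl2 N 3 R 1 * ampl2 N 3 R 0 =
      ampl2 N 3 R 1 * ampl2 N 3 R 0 * ampl2 N 3 R 1)
    (hinv : R * R = 1)
    (Ψ : Matrix (Fin N × Fin N) (Fin N × Fin N) ℂ)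
    (hΨ : ∀ i j k m : Fin N, ∑ a : Fin N, ∑ b : Fin N,
        R (i, b) (j, a) * Ψ (a, k) (b, m) = if i = m ∧ k = j then 1 else 0)
    (C : Matrix (Fin N) (Fin N) ℂ)
    (hC : ∀ i j : Fin N, C i j = ∑ k : Fin N, Ψ (i, k) (j, k))
    (n : ℕ) (hn : 1 ≤ n)
    (P : Matrix (Fin n → Fin N) (Fin n → Fin N) ℂ)
    (hP : P ∈ Algebra.adjoin ℂ
      {M : Matrix (Fin n → Fin N) (Fin n → Fin N) ℂ | ∃ k : ℕ, k + 1 < n ∧ M = ampl2 N n R k}) :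
    ∀ x : REA N R,
      trRn N n C (LtotInv N n R (Lgen N R) * P.map (algebraMap ℂ (REA N R))) * x =
        x * trRn N n C (LtotInv N n R (Lgen N R) * P.map (algebraMap ℂ (REA N R))) := by
  intro x
  have hCR := skew_key N R hbraid hinv Ψ hΨ C hC
  set r := ampl2 N (n+1) (R.map (algebraMap ℂ (REA N R))) with hr
  set l := ampl1 N (n+1) (Lgen N R) 0 with hl
  have hs : ∀ k < n, r k * r k = 1 := by
    intro k hk
    refine ampl2_sq N _ ?_ (n+1) k (by omega)
    rw [← Matrix.map_mul, hinv]; simp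
  have hb : ∀ k, r k * r (k+1) * r k = r (k+1) * r k * r (k+1) := by
    intro k
    refine ampl2_braid N _ ?_ (n+1) k
    simp only [ampl2_map, ← Matrix.map_mul, hbraid]
  have hc : ∀ k m, k + 1 < m → r k * r m = r m * r k := fun k m h => ampl2_comm N R (n+1) k m h
  have hlr : ∀ k, 1 ≤ k → Commute l (r k) := fun k hk => ampl1_comm N R _ (n+1) k hk
  have h0 : Commute l (r 0 * l * r 0) := ampl1_re N _ _ (Lgen_rel N R) (n+1)
  have hud := upU_dnU n hs n le_rfl
  have hdu := dnU_upU n hs n le_rfl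
  -- the conjugated embedding
  set φ : Matrix (Fin n → Fin N) (Fin n → Fin N) (REA N R) →
      Matrix (Fin (n+1) → Fin N) (Fin (n+1) → Fin N) (REA N R) :=
    fun X => upU r n * embE N n X * dnU r n with hφ
  have φmul : ∀ X Y, φ (X * Y) = φ X * φ Y := by
    intro X Y
    simp only [hφ, map_mul]
    calc _ = upU r n * embE N n X * 1 * embE N n Y * dnU r n := by noncomm_ring
      _ = _ := by rw [← hdu]; noncomm_ring
  have φadd : ∀ X Y, φ (X + Y) = φ X + φ Y := by
    intro X Y
    simp only [hφ, map_add]; noncomm_ring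
  have φone : φ 1 = 1 := by simp only [hφ, map_one, mul_one, hud]
  have hLtot : Commute l (φ (LtotInv N n R (Lgen N R))) := by
    refine List.prod_induction (p := fun X => Commute l (φ X)) ?_ ?_ ?_
    · intro X Y hX hY; rw [φmul]; exact hX.mul_right hY
    · rw [φone]; exact Commute.one_right _
    · intro X hX
      obtain ⟨k, hk, rfl⟩ := List.mem_map.mp hX
      have hk := List.mem_range.mp hk
      simp only [hφ, embE_LbarInv N n k R (Lgen N R) hk]
      rw [lbA_shift n hs hb hc hlr k n le_rfl hk]
      exact lbA_comm hlr h0 k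
  have hPc : Commute l (φ (P.map (algebraMap ℂ (REA N R)))) := by
    induction hP using Algebra.adjoin_induction with
    | mem X hX =>
      obtain ⟨k, hk, rfl⟩ := hX
      rw [← ampl2_map]
      simp only [hφ, embE_ampl2 N n k _ hk]
      rw [upU_shift hb hc n k hk, mul_assoc, hud, mul_one]
      exact hlr _ (by omega)
    | algebraMap z =>
      have h1 : (algebraMap ℂ (Matrix (Fin n → Fin N) (Fin n → Fin N) ℂ) z).map
          (algebraMap ℂ (REA N R)) = algebraMap ℂ _ z := by
        ext i j
        simp only [Matrix.map_apply, Matrix.algebraMap_matrix_apply]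
        split_ifs <;> simp
      have h2 : φ (algebraMap ℂ _ z) = algebraMap ℂ _ z := by
        have : embE N n (algebraMap ℂ (Matrix (Fin n → Fin N) (Fin n → Fin N) (REA N R)) z) =
            algebraMap ℂ _ z := by
          refine ext_sn N n fun i j a b => ?_
          rw [embE_sn]
          simp only [Matrix.algebraMap_matrix_apply, EmbeddingLike.apply_eq_iff_eq, Prod.mk.injEq]
          split_ifs <;> simp_all
        simp only [hφ, this]
        rw [← Algebra.commutes, mul_assoc, hud, mul_one]
      rw [h1, h2]
      exact (Algebra.commutes z l).symm
    | add X Y _ _ hX hY =>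
      rw [Matrix.map_add _ (map_add _), φadd]; exact hX.add_right hY
    | mul X Y _ _ hX hY =>
      rw [Matrix.map_mul, φmul]; exact hX.mul_right hY
  have hW := hLtot.mul_right hPc
  rw [← φmul] at hW
  set W := LtotInv N n R (Lgen N R) * P.map (algebraMap ℂ (REA N R)) with hWdef
  have hF := congrArg (trF N C n) hW.eq
  rw [hl, trF_left, trF_right] at hF
  have hgen : ∀ i j : Fin N, Commute (trRn N n C W) (Lgen N R i j) := by
    intro i j
    have h := congrFun (congrFun hF (fun _ => i)) (fun _ => j)
    simp only [Matrix.mul_apply, hφ, hr, trF_conj N n C R hCR] at h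
    simp only [mul_ite, mul_zero, ite_mul, zero_mul, Finset.sum_ite_eq, Finset.sum_ite_eq',
      Finset.mem_univ, if_true] at h
    have ha : ampl1 N 1 (Lgen N R) 0 (fun _ => i) (fun _ => j) = Lgen N R i j := by
      simp [ampl1]
    rw [ha] at h
    exact h.symm
  obtain ⟨y, rfl⟩ := RingQuot.mkAlgHom_surjective ℂ (REArel N R) x
  change Commute (trRn N n C W) _
  induction y using FreeAlgebra.induction with
  | grade0 z => rw [AlgHom.commutes]; exact (Algebra.commutes z _).symm
  | grade1 p => exact hgen p.1 p.2
  | mul a b ha hb => rw [map_mul]; exact ha.mul_right hb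
  | add a b ha hb => rw [map_add]; exact ha.add_right hb
end
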